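/- (Theorem 1(iv)) Let A ⊆ ℝⁿ be a bounded closed set with 0 ∈ A ⊆ B₁ and Ω := ℝⁿ \ A. Let u be continuous on the closure of Ω and infinity harmonic in Ω with limsup_{x→∞} |u(x)|/|x| < +∞. If S⁻_∞ = S⁺_∞ > 0, then there exists a vector a ∈ ℝⁿ with |a| = S_∞ such that u(x) = a·x + o(|x|) as x → ∞, i.e. (u(x) − a·x)/|x| → 0 as |x| → ∞. -/

import Mathlib

open Metric Set Filter Bornology Topology
open scoped RealInnerProductSpace

noncomputable section

/-- Euclidean space ℝⁿ. -/
abbrev Euc (n : ℕ) := EuclideanSpace ℝ (Fin n)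

/-- Comparison with cones from above (infinity subharmonic). -/
def CmpAbove {n : ℕ} (Ω : Set (Euc n)) (u : Euc n → ℝ) : Prop :=
  ∀ V : Set (Euc n), IsOpen V → IsBounded V → closure V ⊆ Ω →
    ∀ (x₀ : Euc n) (a b : ℝ),
      (∀ x ∈ frontier (V \ {x₀}), u x ≤ a * ‖x - x₀‖ + b) →
      ∀ x ∈ V, u x ≤ a * ‖x - x₀‖ + b

/-- Comparison with cones from below (infinity superharmonic). -/
def CmpBelow {n : ℕ} (Ω : Set (Euc n)) (u : Euc n → ℝ) : Prop :=
  ∀ V : Set (Euc n), IsOpen V → IsBounded V → closure V ⊆ Ω →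
    ∀ (x₀ : Euc n) (a b : ℝ),
      (∀ x ∈ frontier (V \ {x₀}), a * ‖x - x₀‖ + b ≤ u x) →
      ∀ x ∈ V, a * ‖x - x₀‖ + b ≤ u x

/-- Infinity harmonic = comparison with cones from both sides. -/
def InfHarmonic {n : ℕ} (Ω : Set (Euc n)) (u : Euc n → ℝ) : Prop :=
  CmpAbove Ω u ∧ CmpBelow Ω u

/-- m⁺ = max of u on ∂Ω. -/
def mP {n : ℕ} (Ω : Set (Euc n)) (u : Euc n → ℝ) : ℝ := sSup (u '' frontier Ω)

/-- m⁻ = min of u on ∂Ω. -/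
def mM {n : ℕ} (Ω : Set (Euc n)) (u : Euc n → ℝ) : ℝ := sInf (u '' frontier Ω)

/-- S⁺_r := (max(max_{∂B_r} u, m⁺) − m⁺)/r. -/
def SP {n : ℕ} (Ω : Set (Euc n)) (u : Euc n → ℝ) (r : ℝ) : ℝ :=
  (max (sSup (u '' sphere (0 : Euc n) r)) (mP Ω u) - mP Ω u) / r

/-- S⁻_r := (m⁻ − min(min_{∂B_r} u, m⁻))/r. -/
def SM {n : ℕ} (Ω : Set (Euc n)) (u : Euc n → ℝ) (r : ℝ) : ℝ :=
  (mM Ω u - min (sInf (u '' sphere (0 : Euc n) r)) (mM Ω u)) / r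

/-- Lip(u, S) := sup_{x≠y ∈ S} |u(x) − u(y)|/|x − y|. -/
def lipOn {n : ℕ} (u : Euc n → ℝ) (S : Set (Euc n)) : ℝ :=
  sSup ((fun p : Euc n × Euc n => |u p.1 - u p.2| / ‖p.1 - p.2‖) ''
    {p : Euc n × Euc n | p.1 ∈ S ∧ p.2 ∈ S ∧ p.1 ≠ p.2})

/-- The doubled functional, with `s`, `t` standing for the values of `u` near `y`, `z`. -/
def doubled {n : ℕ} (e b : Euc n) (B a g : ℝ) (y z : Euc n) (s t : ℝ) : ℝ :=
  s - t - B * ‖y - z + b‖ ^ 2 + a * (t - ⟪e, z⟫) ^ 2 - g * ‖z‖ ^ 2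

/-- First and second order conditions at a local maximum of the doubled functional. -/
lemma doubled_max_conditions {n : ℕ} (u : Euc n → ℝ) (e b : Euc n) {B a g ε : ℝ}
    (hB : 0 < B) (ha : 0 ≤ a) (hg : 0 ≤ g) (hε : 0 < ε) (y z y₁ z₁ Y Z : Euc n)
    (hmax : ∀ y' z' y₁' z₁' : Euc n, ‖y' - y‖ ≤ ε → ‖z' - z‖ ≤ ε → ‖y₁' - y'‖ ≤ ε →
      ‖z₁' - z'‖ ≤ ε →
      doubled e b B a g y' z' (u y₁') (u z₁') ≤ doubled e b B a g y z (u y₁) (u z₁))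
    (hy₁ : ‖y₁ - y‖ ≤ ε) (hz₁ : ‖z₁ - z‖ ≤ ε)
    (hY : ‖Y - y‖ ≤ 2 * ε) (huY : 2 * u y₁ ≤ u y + u Y)
    (hZ : ‖Z - z‖ ≤ 2 * ε) (huZ : u z + u Z ≤ 2 * u z₁)
    {v P : Euc n} {w : ℝ} (hv : v = y - z + b) (hw : w = u z₁ - ⟪e, z⟫)
    (hP : P = (2 * B) • v - (2 * a * w) • e - (2 * g) • z)
    (hw1 : |2 * a * w| ≤ 1 / 2) :
    ∃ (m k : Euc n) (θ : ℝ), ‖m‖ ≤ 1 ∧ ‖k‖ ≤ 1 ∧ ‖v‖ - ε ≤ ⟪m, v⟫ ∧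
      ‖P‖ - 2 * (B + g) * ε ≤ ⟪k, P⟫ ∧ ‖P‖ - (B + g) * ε ≤ (1 - 2 * a * w) * θ ∧
      a * (θ - ⟪e, k⟫) ^ 2 ≤ 2 * B * ‖m - k‖ ^ 2 + 2 * g := by
  have unit_exists : ∀ x : Euc n, ∃ x' : Euc n, ‖x'‖ ≤ 1 ∧ ⟪x, x'⟫ = ‖x‖ := by
    intro x
    by_cases hx : x = 0
    · exact ⟨0, by simp, by simp [hx]⟩
    · have hx' : ‖x‖ ≠ 0 := norm_ne_zero_iff.mpr hx
      refine ⟨‖x‖⁻¹ • x, ?_, ?_⟩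
      · rw [norm_smul, norm_inv, norm_norm, inv_mul_cancel₀ hx']
      · rw [inner_smul_right, real_inner_self_eq_norm_sq]; field_simp
  obtain ⟨m, hm⟩ : ∃ m : Euc n, Y = y + (2 * ε) • m := ⟨(2 * ε)⁻¹ • (Y - y), by
    rw [smul_smul, mul_inv_cancel₀ (by positivity)]; simp⟩
  obtain ⟨k, hk⟩ : ∃ k : Euc n, Z = z - (2 * ε) • k := ⟨(2 * ε)⁻¹ • (z - Z), by
    rw [smul_smul, mul_inv_cancel₀ (by positivity)]; simp⟩
  have hm1 : ‖m‖ ≤ 1 := by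
    rw [hm, add_sub_cancel_left, norm_smul, Real.norm_of_nonneg (by positivity)] at hY
    nlinarith
  have hk1 : ‖k‖ ≤ 1 := by
    rw [hk, sub_sub_cancel_left, norm_neg, norm_smul, Real.norm_of_nonneg (by positivity)] at hZ
    nlinarith
  have step : ∀ x : Euc n, ‖x‖ ≤ 1 → ‖ε • x‖ ≤ ε := by
    intro x hx
    rw [norm_smul, Real.norm_of_nonneg hε.le]; nlinarith
  have sqv : ∀ x : Euc n, ‖v + ε • x‖ ^ 2 = ‖v‖ ^ 2 + 2 * ε * ⟪x, v⟫ + ε ^ 2 * ‖x‖ ^ 2 := by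
    intro x
    rw [norm_add_sq_real, inner_smul_right, norm_smul, Real.norm_of_nonneg hε.le,
      real_inner_comm]; ring
  have sqz : ∀ x : Euc n, ‖z + ε • x‖ ^ 2 = ‖z‖ ^ 2 + 2 * ε * ⟪x, z⟫ + ε ^ 2 * ‖x‖ ^ 2 := by
    intro x
    rw [norm_add_sq_real, inner_smul_right, norm_smul, Real.norm_of_nonneg hε.le,
      real_inner_comm]; ring
  have sq1 : ∀ x : Euc n, ‖x‖ ≤ 1 → ‖x‖ ^ 2 ≤ 1 := fun x hx => by nlinarith [norm_nonneg x]
  -- moving both points at once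
  have move : ∀ (p q y₁' z₁' : Euc n), ‖p‖ ≤ 1 → ‖q‖ ≤ 1 → ‖y₁' - (y + ε • p)‖ ≤ ε →
      ‖z₁' - (z + ε • q)‖ ≤ ε →
      u y₁' - u z₁' - B * (2 * ε * ⟪p - q, v⟫ + ε ^ 2 * ‖p - q‖ ^ 2)
        + a * (u z₁' - ⟪e, z⟫ - ε * ⟪e, q⟫) ^ 2 - a * w ^ 2
        - g * (2 * ε * ⟪q, z⟫ + ε ^ 2 * ‖q‖ ^ 2) ≤ u y₁ - u z₁ := by
    intro p q y₁' z₁' hp hq h1 h2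
    have h := hmax (y + ε • p) (z + ε • q) y₁' z₁' (by simpa using step p hp)
      (by simpa using step q hq) h1 h2
    have e1 : y + ε • p - (z + ε • q) + b = v + ε • (p - q) := by
      rw [hv, smul_sub]; abel
    simp only [doubled] at h
    rw [e1, sqv, sqz, ← hv, inner_add_right, inner_smul_right, ← hw] at h
    linarith
  have hyk : ∀ p : Euc n, ‖p‖ ≤ 1 → ‖y - (y + ε • p)‖ ≤ ε := fun p hp => by
    simpa using step p hp
  have hzk : ∀ p : Euc n, ‖p‖ ≤ 1 → ‖z - (z + ε • p)‖ ≤ ε := fun p hp => by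
    simpa using step p hp
  have hYm : ‖Y - (y + ε • m)‖ ≤ ε := by
    have : Y - (y + ε • m) = ε • m := by rw [hm, two_mul, add_smul]; abel
    rw [this]; exact step m hm1
  have hZk : ‖Z - (z + ε • (-k))‖ ≤ ε := by
    have : Z - (z + ε • (-k)) = ε • (-k) := by rw [hk, two_mul, add_smul, smul_neg]; abel
    rw [this]; exact step _ (by simpa using hk1)
  have hz₁0 : ‖z₁ - (z + ε • (0 : Euc n))‖ ≤ ε := by simpa using hz₁
  have hy₁0 : ‖y₁ - (y + ε • (0 : Euc n))‖ ≤ ε := by simpa using hy₁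
  refine ⟨m, k, (u z₁ - u Z) / ε, hm1, hk1, ?_, ?_⟩
  · obtain ⟨x, hx1, hx⟩ := unit_exists v
    have h1 := move m 0 Y z₁ hm1 (by simp) hYm hz₁0
    have h2 := move (-x) 0 y z₁ (by simpa using hx1) (by simp)
      (hyk _ (by simpa using hx1)) hz₁0
    simp only [sub_zero, inner_zero_right, inner_zero_left, mul_zero, ← hw, norm_zero,
      inner_neg_left, norm_neg] at h1 h2
    rw [real_inner_comm, hx] at h2
    have h3 : 0 ≤ ε * (B * (⟪m, v⟫ - ‖v‖ + ε)) := by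
      linarith [mul_nonneg (mul_nonneg hB.le (sq_nonneg ε)) (sub_nonneg.2 (sq1 m hm1)),
        mul_nonneg (mul_nonneg hB.le (sq_nonneg ε)) (sub_nonneg.2 (sq1 x hx1))]
    have := nonneg_of_mul_nonneg_right (nonneg_of_mul_nonneg_right h3 hε) hB
    linarith
  have zmove : ∀ (q z₁' : Euc n), ‖q‖ ≤ 1 → ‖z₁' - (z + ε • q)‖ ≤ ε →
      ε * ⟪q, P⟫ - (B + g) * ε ^ 2 ≤ (1 - 2 * a * w) * (u z₁' - u z₁) := by
    intro q z₁' hq h2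
    have h := move 0 q y₁ z₁' (by simp) hq hy₁0 h2
    have e1 : ⟪q, P⟫ = 2 * B * ⟪q, v⟫ - 2 * a * w * ⟪e, q⟫ - 2 * g * ⟪q, z⟫ := by
      rw [hP, inner_sub_right, inner_sub_right, inner_smul_right, inner_smul_right,
        inner_smul_right, real_inner_comm e q]
    simp only [zero_sub, inner_neg_left, norm_neg] at h
    rw [e1]
    have e2 : u z₁' - ⟪e, z⟫ - ε * ⟪e, q⟫ = w + (u z₁' - u z₁ - ε * ⟪e, q⟫) := by rw [hw]; ring
    rw [e2] at h
    linarith [mul_nonneg ha (sq_nonneg (u z₁' - u z₁ - ε * ⟪e, q⟫)),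
      mul_nonneg (mul_nonneg (add_nonneg hB.le hg) (sq_nonneg ε)) (sub_nonneg.2 (sq1 q hq))]
  obtain ⟨x, hx1, hx⟩ := unit_exists P
  have hκ : 0 < 1 - 2 * a * w := by linarith [(abs_le.1 hw1).2]
  have h1 := zmove x z hx1 (hzk x hx1)
  rw [real_inner_comm, hx] at h1
  have h2 := zmove (-k) Z (by simpa using hk1) hZk
  rw [inner_neg_left] at h2
  have h3 : (1 - 2 * a * w) * (u z - u z₁) ≤ (1 - 2 * a * w) * (u z₁ - u Z) :=
    mul_le_mul_of_nonneg_left (by linarith) hκ.le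
  refine ⟨?_, ?_, ?_⟩
  · have : 0 ≤ ε * (⟪k, P⟫ - ‖P‖ + 2 * (B + g) * ε) := by linarith
    linarith [nonneg_of_mul_nonneg_right this hε]
  · rw [← mul_div_assoc, le_div_iff₀ hε]; linarith
  · have hA := move m k Y z hm1 hk1 hYm (hzk k hk1)
    have hB' := move (-m) (-k) y Z (by simpa using hm1) (by simpa using hk1)
      (hyk _ (by simpa using hm1)) hZk
    have e3 : -m - -k = -(m - k) := by abel
    rw [e3] at hB'
    simp only [inner_neg_left, inner_neg_right, norm_neg] at hB'
    set σ := 2 * u z₁ - u Z - u z with hσ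
    set ΔA := u z - u z₁ - ε * ⟪e, k⟫ with hΔA
    set ΔB := u Z - u z₁ + ε * ⟪e, k⟫ with hΔB
    have eA : u z - ⟪e, z⟫ - ε * ⟪e, k⟫ = w + ΔA := by rw [hw, hΔA]; ring
    have eB : u Z - ⟪e, z⟫ - ε * -⟪e, k⟫ = w + ΔB := by rw [hw, hΔB]; ring
    rw [eA] at hA
    rw [eB] at hB'
    have hsum : ΔA + ΔB = -σ := by rw [hΔA, hΔB, hσ]; ring
    have hσ0 : 0 ≤ σ := by rw [hσ]; linarith
    have e4 : a * (w + ΔA) ^ 2 + a * (w + ΔB) ^ 2 - 2 * (a * w ^ 2)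
        = a * ΔA ^ 2 + a * ΔB ^ 2 - 2 * a * w * σ := by
      linear_combination (2 * a * w) * hsum
    have h5 : 2 * a * w * σ ≤ 1 * σ :=
      mul_le_mul_of_nonneg_right (by linarith) hσ0
    have hkey : a * ΔB ^ 2 ≤ ε ^ 2 * (2 * B * ‖m - k‖ ^ 2 + 2 * g) := by
      linarith [mul_nonneg ha (sq_nonneg ΔA),
        mul_nonneg (mul_nonneg hg (sq_nonneg ε)) (sub_nonneg.2 (sq1 k hk1))]
    have e6 : ΔB = -(ε * ((u z₁ - u Z) / ε - ⟪e, k⟫)) := by rw [hΔB]; field_simp; ring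
    rw [e6] at hkey
    have : ε ^ 2 * (a * ((u z₁ - u Z) / ε - ⟪e, k⟫) ^ 2) ≤
        ε ^ 2 * (2 * B * ‖m - k‖ ^ 2 + 2 * g) := by linarith
    exact le_of_mul_le_mul_left this (by positivity)

lemma norm_sub_normalize_sq_le {n : ℕ} {m x : Euc n} {δ : ℝ} (hm : ‖m‖ ≤ 1) (hx : 0 < ‖x‖)
    (h : ‖x‖ - δ ≤ ⟪m, x⟫) : ‖m - ‖x‖⁻¹ • x‖ ^ 2 ≤ 2 * δ / ‖x‖ := by
  have h1 : ‖‖x‖⁻¹ • x‖ = 1 := by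
    rw [norm_smul, norm_inv, norm_norm, inv_mul_cancel₀ hx.ne']
  rw [norm_sub_sq_real, h1, inner_smul_right, le_div_iff₀ hx]
  have : ‖m‖ ^ 2 ≤ 1 := by nlinarith [norm_nonneg m]
  have h2 : (‖m‖ ^ 2 - 2 * (‖x‖⁻¹ * ⟪m, x⟫) + 1 ^ 2) * ‖x‖
      = (‖m‖ ^ 2 + 1) * ‖x‖ - 2 * ⟪m, x⟫ := by field_simp; ring
  rw [h2]
  nlinarith

lemma norm_normalize_sub_normalize_le {n : ℕ} {x y : Euc n} (hx : 0 < ‖x‖) (hy : 0 < ‖y‖) :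
    ‖‖x‖⁻¹ • x - ‖y‖⁻¹ • y‖ ≤ 2 * ‖y - x‖ / ‖x‖ := by
  have e : ‖x‖⁻¹ • x - ‖y‖⁻¹ • y
      = ‖x‖⁻¹ • (x - y) + (‖x‖⁻¹ * (‖y‖ - ‖x‖)) • (‖y‖⁻¹ • y) := by
    rw [smul_sub, smul_smul]
    have : ‖x‖⁻¹ * (‖y‖ - ‖x‖) * ‖y‖⁻¹ = ‖x‖⁻¹ - ‖y‖⁻¹ := by field_simp
    rw [this, sub_smul]; abel
  have h1 : ‖‖y‖⁻¹ • y‖ = 1 := by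
    rw [norm_smul, norm_inv, norm_norm, inv_mul_cancel₀ hy.ne']
  have h2 : |‖y‖ - ‖x‖| ≤ ‖y - x‖ := abs_norm_sub_norm_le y x
  calc _ ≤ ‖‖x‖⁻¹ • (x - y)‖ + ‖(‖x‖⁻¹ * (‖y‖ - ‖x‖)) • (‖y‖⁻¹ • y)‖ := by
        rw [e]; exact norm_add_le _ _
    _ = ‖x‖⁻¹ * ‖y - x‖ + ‖x‖⁻¹ * |‖y‖ - ‖x‖| := by
        rw [norm_smul, norm_smul, h1, norm_inv, norm_norm, norm_mul, norm_inv, norm_norm,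
          Real.norm_eq_abs, norm_sub_rev x y, mul_one]
    _ ≤ ‖x‖⁻¹ * ‖y - x‖ + ‖x‖⁻¹ * ‖y - x‖ := by gcongr
    _ = _ := by field_simp; ring

/-- If `m` and `k` are almost aligned with the nearby vectors `(2 * B) • v` and `P`, they are
close to each other, and `k` is close to the direction of `v`. -/
lemma almost_aligned_close {n : ℕ} {m k v P : Euc n} {B g ε ρ : ℝ}
    (hB : 0 < B) (hg : 0 ≤ g) (hε : 0 < ε) (hm : ‖m‖ ≤ 1) (hk : ‖k‖ ≤ 1)
    (hmv : ‖v‖ - ε ≤ ⟪m, v⟫) (hkP : ‖P‖ - 2 * (B + g) * ε ≤ ⟪k, P⟫)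
    (hv1 : 1 / 2 ≤ 2 * B * ‖v‖) (hP : ‖P - (2 * B) • v‖ ≤ ρ) (hρ : ρ ≤ 1 / 40) :
    ‖m - k‖ ^ 2 ≤ 48 * ρ ^ 2 + 72 * ((B + g) * ε) ∧
      ‖k - ‖v‖⁻¹ • v‖ ^ 2 ≤ 32 * ρ ^ 2 + 32 * ((B + g) * ε) := by
  have hv0 : 0 < ‖v‖ := by
    by_contra h
    have : ‖v‖ = 0 := le_antisymm (not_lt.1 h) (norm_nonneg v)
    rw [this] at hv1; norm_num at hv1
  have hρ0 : 0 ≤ ρ := (norm_nonneg _).trans hP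
  have hτ0 : 0 ≤ (B + g) * ε := by positivity
  have nV : ‖(2 * B) • v‖ = 2 * B * ‖v‖ := by
    rw [norm_smul, Real.norm_of_nonneg (by positivity)]
  have hPl : 2 * B * ‖v‖ - ρ ≤ ‖P‖ := by
    have := norm_sub_norm_le ((2 * B) • v) P
    rw [nV, norm_sub_rev] at this; linarith
  have hP4 : 1 / 4 ≤ ‖P‖ := by linarith
  have hP0 : 0 < ‖P‖ := by linarith
  have hV0 : 0 < ‖(2 * B) • v‖ := by rw [nV]; linarith
  set v' := ‖v‖⁻¹ • v with hv'
  set P' := ‖P‖⁻¹ • P with hP'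
  have hV' : ‖(2 * B) • v‖⁻¹ • (2 * B) • v = v' := by
    rw [nV, hv', smul_smul]; congr 1; field_simp
  have d1 : ‖m - v'‖ ^ 2 ≤ 8 * (B * ε) := by
    refine (norm_sub_normalize_sq_le hm hv0 hmv).trans ?_
    rw [div_le_iff₀ hv0]; nlinarith
  have d2 : ‖k - P'‖ ^ 2 ≤ 16 * ((B + g) * ε) := by
    refine (norm_sub_normalize_sq_le hk hP0 hkP).trans ?_
    rw [div_le_iff₀ hP0]; nlinarith
  have d3 : ‖v' - P'‖ ≤ 4 * ρ := by
    have := norm_normalize_sub_normalize_le hV0 hP0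
    rw [hV', nV] at this
    refine this.trans ?_
    rw [div_le_iff₀ (by linarith)]
    linarith [mul_le_mul_of_nonneg_left hv1 (by positivity : 0 ≤ 4 * ρ)]
  have d3' : ‖v' - P'‖ ^ 2 ≤ 16 * ρ ^ 2 := by nlinarith [norm_nonneg (v' - P')]
  have hBε : B * ε ≤ (B + g) * ε := by nlinarith
  constructor
  · have : ‖m - k‖ ≤ ‖m - v'‖ + ‖v' - P'‖ + ‖k - P'‖ := by
      calc ‖m - k‖ = ‖(m - v') + (v' - P') - (k - P')‖ := by congr 1; abel
        _ ≤ _ := (norm_sub_le _ _).trans (by gcongr; exact norm_add_le _ _)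
    have h2 : ‖m - k‖ ^ 2 ≤ (‖m - v'‖ + ‖v' - P'‖ + ‖k - P'‖) ^ 2 := by gcongr
    have h3 : ∀ x y z : ℝ, (x + y + z) ^ 2 ≤ 3 * (x ^ 2 + y ^ 2 + z ^ 2) := fun x y z => by
      linarith [sq_nonneg (x - y), sq_nonneg (x - z), sq_nonneg (y - z)]
    linarith [h3 ‖m - v'‖ ‖v' - P'‖ ‖k - P'‖]
  · have : ‖k - v'‖ ≤ ‖k - P'‖ + ‖v' - P'‖ := by
      calc ‖k - v'‖ = ‖(k - P') - (v' - P')‖ := by congr 1; abel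
        _ ≤ _ := norm_sub_le _ _
    have h2 : ‖k - v'‖ ^ 2 ≤ (‖k - P'‖ + ‖v' - P'‖) ^ 2 := by gcongr
    have h3 : ∀ x y : ℝ, (x + y) ^ 2 ≤ 2 * (x ^ 2 + y ^ 2) := fun x y => by
      linarith [sq_nonneg (x - y)]
    have h4 := h3 ‖k - P'‖ ‖v' - P'‖
    linarith

/-- Quantitative consequence of the conditions in `doubled_max_conditions`. -/
lemma doubled_max_bound {n : ℕ} {e m k v P : Euc n} {θ w a B g ε κ ρ : ℝ}
    (he : ‖e‖ = 1) (hB : 0 < B) (ha : 0 ≤ a) (hg : 0 ≤ g) (hε : 0 < ε)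
    (hm : ‖m‖ ≤ 1) (hk : ‖k‖ ≤ 1)
    (hmv : ‖v‖ - ε ≤ ⟪m, v⟫) (hkP : ‖P‖ - 2 * (B + g) * ε ≤ ⟪k, P⟫)
    (hθ : ‖P‖ - (B + g) * ε ≤ (1 - 2 * a * w) * θ)
    (hgain : a * (θ - ⟪e, k⟫) ^ 2 ≤ 2 * B * ‖m - k‖ ^ 2 + 2 * g)
    (hv1 : 1 / 2 ≤ 2 * B * ‖v‖) (hv2 : 2 * B * ‖v‖ ≤ 3 / 2)
    (hκ0 : 0 < κ) (hκ1 : κ ≤ 1) (hP : ‖P - (2 * B) • v‖ ≤ ρ) (haw : |2 * a * w| ≤ ρ)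
    (hρ : ρ ≤ κ / 40) (hτ : (B + g) * ε ≤ κ ^ 2 / 1000)
    (hsep : κ * ‖v‖ ≤ 2 * B * ‖v‖ ^ 2 - ⟪e, v⟫) :
    a * (κ / 2) ^ 2 ≤ 2 * B * (48 * ρ ^ 2 + 72 * (B + g) * ε) + 2 * g := by
  have hv0 : 0 < ‖v‖ := by
    by_contra h
    have : ‖v‖ = 0 := le_antisymm (not_lt.1 h) (norm_nonneg v)
    rw [this] at hv1; norm_num at hv1
  have hρ0 : 0 ≤ ρ := (norm_nonneg _).trans hP
  have hτ0 : 0 ≤ (B + g) * ε := by positivity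
  have hPl : 2 * B * ‖v‖ - ρ ≤ ‖P‖ := by
    have := norm_sub_norm_le ((2 * B) • v) P
    rw [norm_smul, Real.norm_of_nonneg (by positivity), norm_sub_rev] at this; linarith
  obtain ⟨hmk, hkv2⟩ := almost_aligned_close hB hg hε hm hk hmv hkP hv1 hP (by linarith)
  set v' := ‖v‖⁻¹ • v with hv'
  have hkv : ‖k - v'‖ ≤ κ / 4 := by
    have hρ2 : ρ ^ 2 ≤ (κ / 40) ^ 2 := by gcongr
    refine le_of_sq_le_sq ?_ (by positivity)
    linarith [sq_nonneg κ]
  have hek : ⟪e, k⟫ ≤ 2 * B * ‖v‖ - κ + κ / 4 := by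
    have h1 : ⟪e, v'⟫ ≤ 2 * B * ‖v‖ - κ := by
      rw [hv', inner_smul_right, inv_mul_le_iff₀ hv0]; nlinarith
    have h2 : ⟪e, k - v'⟫ ≤ κ / 4 :=
      (real_inner_le_norm _ _).trans (by rw [he, one_mul]; exact hkv)
    rw [inner_sub_right] at h2; linarith
  have haw' := abs_le.1 haw
  have hθl : 2 * B * ‖v‖ - 4 * ρ - 2 * ((B + g) * ε) ≤ θ := by
    by_contra hc
    push Not at hc
    have hκ2 : κ ^ 2 ≤ 1 := by nlinarith
    have hT : 0 ≤ 2 * B * ‖v‖ - 4 * ρ - 2 * ((B + g) * ε) := by linarith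
    have h1 : (1 - 2 * a * w) * θ ≤
        (1 + ρ) * (2 * B * ‖v‖ - 4 * ρ - 2 * ((B + g) * ε)) :=
      (mul_le_mul_of_nonneg_left hc.le (by linarith)).trans
        (mul_le_mul_of_nonneg_right (by linarith) hT)
    have h2 : ρ * (2 * B * ‖v‖ - 4 * ρ - 2 * ((B + g) * ε)) ≤ ρ * (3 / 2) :=
      mul_le_mul_of_nonneg_left (by linarith) hρ0
    have h3 : 0 < (1 - 2 * a * w) *
        (2 * B * ‖v‖ - 4 * ρ - 2 * ((B + g) * ε) - θ) :=
      mul_pos (by linarith) (by linarith)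
    have h4 : (1 - 2 * a * w) * (2 * B * ‖v‖ - 4 * ρ - 2 * ((B + g) * ε)) ≤
        (1 + ρ) * (2 * B * ‖v‖ - 4 * ρ - 2 * ((B + g) * ε)) :=
      mul_le_mul_of_nonneg_right (by linarith) hT
    linarith
  have hκ2 : κ ^ 2 ≤ κ := by nlinarith
  have hθk : κ / 2 ≤ θ - ⟪e, k⟫ := by linarith
  calc a * (κ / 2) ^ 2 ≤ a * (θ - ⟪e, k⟫) ^ 2 := by gcongr
    _ ≤ 2 * B * ‖m - k‖ ^ 2 + 2 * g := hgain
    _ ≤ 2 * B * (48 * ρ ^ 2 + 72 * ((B + g) * ε)) + 2 * g := by gcongr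
    _ = _ := by ring

/-- The set over which the doubled functional is maximised. -/
def doubledDomain (n : ℕ) (r R ε : ℝ) : Set (Euc n × Euc n × Euc n × Euc n) :=
  {p | r ≤ ‖p.2.1‖ ∧ ‖p.2.1‖ ≤ R ∧ ‖p.1 - p.2.1‖ ≤ 1 ∧ ‖p.2.2.1 - p.1‖ ≤ ε ∧
    ‖p.2.2.2 - p.2.1‖ ≤ ε}

lemma isCompact_doubledDomain (n : ℕ) (r R ε : ℝ) : IsCompact (doubledDomain n r R ε) := by
  apply Metric.isCompact_of_isClosed_isBounded
  · unfold doubledDomain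
    simp only [Set.ofPred_and]
    refine IsClosed.inter (isClosed_le (by fun_prop) (by fun_prop)) <|
      IsClosed.inter (isClosed_le (by fun_prop) (by fun_prop)) <|
      IsClosed.inter (isClosed_le (by fun_prop) (by fun_prop)) <|
      IsClosed.inter (isClosed_le (by fun_prop) (by fun_prop))
      (isClosed_le (by fun_prop) (by fun_prop))
  · refine (isBounded_iff_forall_norm_le).2 ⟨|R| + 1 + |ε|, ?_⟩
    rintro ⟨y, z, y₁, z₁⟩ ⟨-, h1, h2, h3, h4⟩
    simp only at h1 h2 h3 h4
    have a1 := norm_le_norm_sub_add y z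
    have a2 := norm_le_norm_sub_add y₁ y
    have a3 := norm_le_norm_sub_add z₁ z
    have := le_abs_self R
    have := le_abs_self ε
    have := abs_nonneg ε
    simp only [Prod.norm_mk, max_le_iff]
    refine ⟨?_, ?_, ?_, ?_⟩ <;> linarith

lemma exists_doubled_max {n : ℕ} {u : Euc n → ℝ} {r R ε : ℝ} (hε : ε ≤ 1)
    (hcont : ContinuousOn u {x | r - 3 ≤ ‖x‖}) (e b : Euc n) (B a g : ℝ)
    (hne : (doubledDomain n r R ε).Nonempty) :
    ∃ p ∈ doubledDomain n r R ε, ∀ q ∈ doubledDomain n r R ε,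
      doubled e b B a g q.1 q.2.1 (u q.2.2.1) (u q.2.2.2)
        ≤ doubled e b B a g p.1 p.2.1 (u p.2.2.1) (u p.2.2.2) := by
  have c1 : ContinuousOn (fun p : Euc n × Euc n × Euc n × Euc n => u p.2.2.1)
      (doubledDomain n r R ε) := by
    refine hcont.comp (by fun_prop) ?_
    rintro ⟨y, z, y₁, z₁⟩ ⟨h0, h1, h2, h3, h4⟩
    simp only [mem_ofPred_eq] at h0 h1 h2 h3 h4 ⊢
    have := norm_le_norm_sub_add z y
    have := norm_le_norm_sub_add y y₁
    rw [norm_sub_rev] at h2 h3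
    linarith
  have c2 : ContinuousOn (fun p : Euc n × Euc n × Euc n × Euc n => u p.2.2.2)
      (doubledDomain n r R ε) := by
    refine hcont.comp (by fun_prop) ?_
    rintro ⟨y, z, y₁, z₁⟩ ⟨h0, h1, h2, h3, h4⟩
    simp only [mem_ofPred_eq] at h0 h1 h2 h3 h4 ⊢
    have := norm_le_norm_sub_add z z₁
    rw [norm_sub_rev] at h4
    linarith
  refine (isCompact_doubledDomain n r R ε).exists_isMaxOn (f := fun p =>
    doubled e b B a g p.1 p.2.1 (u p.2.2.1) (u p.2.2.2)) hne ?_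
  exact (((c1.sub c2).sub (by fun_prop)).add (continuousOn_const.mul
    ((c2.sub (by fun_prop)).pow 2))).sub (by fun_prop)

/-- If `v - h • e` is almost as long as `v` can be, `v` is separated from the direction `e`. -/
lemma separation_of_long {n : ℕ} {e v : Euc n} (he : ‖e‖ = 1) {h c : ℝ} (hh : 0 < h)
    (hh1 : h ≤ 1 / 40) (hc : 0 < c) (hhc : h ≤ c / 10)
    (hlong : 1 / 5 - h + h * c + 5 / 4 * ‖v‖ ^ 2 ≤ ‖v - h • e‖) :
    1 / 2 ≤ 2 * (5 / 4) * ‖v‖ ∧ 2 * (5 / 4) * ‖v‖ ≤ 3 / 2 ∧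
      c / 6 * ‖v‖ ≤ 2 * (5 / 4) * ‖v‖ ^ 2 - ⟪e, v⟫ := by
  have hhc0 : 0 < h * c := mul_pos hh hc
  have h1 : ‖v - h • e‖ ≤ ‖v‖ + h := by
    refine (norm_sub_le _ _).trans ?_
    rw [norm_smul, he, Real.norm_of_nonneg hh.le, mul_one]
  have hs : (5 / 2 * ‖v‖ - 1) ^ 2 ≤ (1 / 2) ^ 2 := by nlinarith
  have hs' := abs_le_of_sq_le_sq' hs (by norm_num)
  refine ⟨by linarith, by linarith, ?_⟩
  have hsq : ‖v - h • e‖ ^ 2 = ‖v‖ ^ 2 - 2 * h * ⟪e, v⟫ + h ^ 2 := by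
    rw [norm_sub_sq_real, inner_smul_right, norm_smul, he, Real.norm_of_nonneg hh.le,
      real_inner_comm]; ring
  have hD : (1 / 5 - h + h * c + 5 / 4 * ‖v‖ ^ 2) ^ 2 ≤ ‖v - h • e‖ ^ 2 := by
    have : 0 ≤ 1 / 5 - h + h * c + 5 / 4 * ‖v‖ ^ 2 := by
      have := sq_nonneg ‖v‖
      linarith
    gcongr
  rw [hsq] at hD
  set x := ‖v‖
  set t := 1 / 5 - 5 / 4 * x ^ 2 with ht
  have hkey : 0 ≤ h * (2 * (2 * (5 / 4) * x ^ 2 - ⟪e, v⟫) - 2 * (c / 6 * x)) := by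
    have k1 : h * h ≤ h * (c / 10) := mul_le_mul_of_nonneg_left hhc hh.le
    have k2 : h * c * x ≤ h * c * (3 / 5) := mul_le_mul_of_nonneg_left (by linarith) hhc0.le
    have k3 : 0 ≤ h * c * x ^ 2 := by positivity
    have id : (1 / 5 - h + h * c + 5 / 4 * x ^ 2) ^ 2 - x ^ 2 - h ^ 2 + 5 * h * x ^ 2
      = (t - h) ^ 2 - 2 * (h * h) + 2 * (h * c) * (1 / 5 + 5 / 4 * x ^ 2)
        + (h * (1 - c)) ^ 2 := by rw [ht]; ring
    linarith [sq_nonneg (t - h), sq_nonneg (h * (1 - c))]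
  linarith [nonneg_of_mul_nonneg_right hkey hh]

/-- With the parameters chosen suitably, the doubled functional has no local maximum at which
`y - z` is as long as possible. -/
lemma doubled_no_local_max {n : ℕ} {u : Euc n → ℝ} {e : Euc n} (he : ‖e‖ = 1)
    {h c R ε a g κ : ℝ} (hh : 0 < h) (hh1 : h ≤ 1 / 40) (hc : 0 < c) (hhc : h ≤ c / 10)
    (hc1 : c ≤ 1) (hR : 0 < R) (hε : 0 < ε) (hκ : κ = c / 6) (ha : a = 20000 / κ ^ 2 * h / R ^ 2)
    (hg : g = 16 * h / R ^ 2) (hρ : 34 * h / R ≤ κ / 40)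
    (hτ : (5 / 4 + g) * ε ≤ κ ^ 2 / 1000) (hτ' : (5 / 4 + g) * ε ≤ h / (180 * R ^ 2))
    (y z y₁ z₁ Y Z : Euc n) (hz : ‖z‖ ≤ R) (haw : |2 * a * (u z₁ - ⟪e, z⟫)| ≤ 2 * h / R)
    (hlong : 1 / 5 - h + h * c + 5 / 4 * ‖y - z + h • e‖ ^ 2 ≤ ‖y - z‖)
    (hmax : ∀ y' z' y₁' z₁' : Euc n, ‖y' - y‖ ≤ ε → ‖z' - z‖ ≤ ε → ‖y₁' - y'‖ ≤ ε →
      ‖z₁' - z'‖ ≤ ε → doubled e (h • e) (5 / 4) a g y' z' (u y₁') (u z₁')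
        ≤ doubled e (h • e) (5 / 4) a g y z (u y₁) (u z₁))
    (hy₁ : ‖y₁ - y‖ ≤ ε) (hz₁ : ‖z₁ - z‖ ≤ ε)
    (hY : ‖Y - y‖ ≤ 2 * ε) (huY : 2 * u y₁ ≤ u y + u Y)
    (hZ : ‖Z - z‖ ≤ 2 * ε) (huZ : u z + u Z ≤ 2 * u z₁) : False := by
  have hκ0 : 0 < κ := by rw [hκ]; linarith
  have ha0 : 0 ≤ a := by rw [ha]; positivity
  have hg0 : 0 ≤ g := by rw [hg]; positivity
  have hlong' : 1 / 5 - h + h * c + 5 / 4 * ‖y - z + h • e‖ ^ 2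
      ≤ ‖y - z + h • e - h • e‖ := by simpa using hlong
  obtain ⟨s1, s2, s3⟩ := separation_of_long he hh hh1 hc hhc hlong'
  rw [← hκ] at s3
  have hgz : ‖(2 * g) • z‖ ≤ 32 * h / R := by
    rw [norm_smul, Real.norm_of_nonneg (by positivity)]
    calc 2 * g * ‖z‖ ≤ 2 * g * R := by gcongr
      _ = 32 * h / R := by rw [hg]; field_simp; ring
  have hhR : 0 < h / R := by positivity
  have e1 : 34 * h / R = 34 * (h / R) := by ring
  have e2 : 2 * h / R = 2 * (h / R) := by ring
  have e3 : 32 * h / R = 32 * (h / R) := by ring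
  have hκ1 : κ ≤ 1 := by rw [hκ]; linarith
  obtain ⟨m, k, θ, q1, q2, q3, q4, q5, q6⟩ := doubled_max_conditions u e (h • e)
    (by norm_num) ha0 hg0 hε y z y₁ z₁ Y Z hmax hy₁ hz₁ hY huY hZ huZ rfl rfl rfl
    (haw.trans (by rw [e2]; linarith))
  have hP : ‖(2 * (5 / 4 : ℝ)) • (y - z + h • e) - (2 * a * (u z₁ - ⟪e, z⟫)) • e - (2 * g) • z
      - (2 * (5 / 4 : ℝ)) • (y - z + h • e)‖ ≤ 34 * h / R := by
    have : (2 * (5 / 4 : ℝ)) • (y - z + h • e) - (2 * a * (u z₁ - ⟪e, z⟫)) • e - (2 * g) • z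
      - (2 * (5 / 4 : ℝ)) • (y - z + h • e)
      = -((2 * a * (u z₁ - ⟪e, z⟫)) • e + (2 * g) • z) := by abel
    rw [this, norm_neg]
    refine (norm_add_le _ _).trans ?_
    rw [norm_smul (2 * a * (u z₁ - ⟪e, z⟫)) e, he, Real.norm_eq_abs]
    linarith
  have hfin := doubled_max_bound he (by norm_num) ha0 hg0 hε q1 q2 q3 q4 q5 q6 s1 s2 hκ0 hκ1 hP
    (haw.trans (by linarith)) hρ hτ s3
  have f1 : a * (κ / 2) ^ 2 = 5000 * (h / R ^ 2) := by rw [ha]; field_simp; ring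
  have f2 : (34 * h / R) ^ 2 ≤ 34 ^ 2 / 40 * (h / R ^ 2) := by
    calc (34 * h / R) ^ 2 = 34 ^ 2 * (h / R ^ 2) * h := by field_simp
      _ ≤ 34 ^ 2 * (h / R ^ 2) * (1 / 40) := by gcongr
      _ = _ := by ring
  have f3 : h / (180 * R ^ 2) = (h / R ^ 2) / 180 := by field_simp
  have f4 : 2 * g = 32 * (h / R ^ 2) := by rw [hg]; ring
  have f5 : 0 < h / R ^ 2 := by positivity
  rw [f1, f4] at hfin
  rw [f3] at hτ'
  linarith

/-- Where the doubled functional can take a value above `1 / 5 - h + 2 * h * c`. -/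
lemma doubled_large_location {n : ℕ} {u : Euc n → ℝ} {e : Euc n} (he : ‖e‖ = 1)
    {h c r R ε a g η : ℝ} (hh : 0 < h) (hc : 0 < c) (hη0 : 0 < η) (hη1 : η ≤ 1)
    (hhη : h ≤ η / 10) (hR : 0 < R)
    (hg : g = 16 * h / R ^ 2) (hεh : 2 * ε ≤ h * c / 2) (y z y₁ z₁ : Euc n)
    (haw : a * (u z₁ - ⟪e, z⟫) ^ 2 ≤ h * c / 2)
    (hy₁ : u y₁ ≤ u y + ε) (hz₁ : u z ≤ u z₁ + ε) (hyz : u y - u z ≤ ‖y - z‖)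
    (hgap : ‖z‖ ≤ r + 1 → u y - u z ≤ (1 - η) * ‖y - z‖)
    (hval : 1 / 5 - h + 2 * (h * c) ≤ doubled e (h • e) (5 / 4) a g y z (u y₁) (u z₁)) :
    r + 1 < ‖z‖ ∧ ‖z‖ < R / 2 ∧
      1 / 5 - h + h * c + 5 / 4 * ‖y - z + h • e‖ ^ 2 ≤ ‖y - z‖ := by
  have hhc : 0 < h * c := mul_pos hh hc
  unfold doubled at hval
  have hg0 : 0 ≤ g := by rw [hg]; positivity
  have hlen : ‖y - z‖ ≤ ‖y - z + h • e‖ + h := by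
    have := norm_sub_le (y - z + h • e) (h • e)
    rwa [add_sub_cancel_right, norm_smul, he, Real.norm_of_nonneg hh.le, mul_one] at this
  set x := ‖y - z + h • e‖
  have hgz : 0 ≤ g * ‖z‖ ^ 2 := by positivity
  have hD0 : 0 ≤ ‖y - z‖ := norm_nonneg _
  refine ⟨?_, ?_, by linarith⟩
  · by_contra! hcon
    have h1 := hgap hcon
    have h2 : (1 - η) * ‖y - z‖ ≤ (1 - η) * (x + h) :=
      mul_le_mul_of_nonneg_left hlen (by linarith)
    have h3 : (1 - η) * h ≤ 1 * h := mul_le_mul_of_nonneg_right (by linarith) hh.le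
    have h4 : (1 - η) * x ≤ 5 / 4 * x ^ 2 + (1 - η) ^ 2 / 5 := by
      linarith [sq_nonneg (5 / 2 * x - (1 - η))]
    have h5 : (1 - η) ^ 2 ≤ 1 - η := by nlinarith
    linarith
  · by_contra! hcon
    have h1 : 4 * h ≤ g * ‖z‖ ^ 2 := by
      calc 4 * h = g * (R / 2) ^ 2 := by rw [hg]; field_simp; ring
        _ ≤ _ := by gcongr
    linarith [sq_nonneg (5 / 2 * x - 1)]

set_option maxHeartbeats 800000 in
/-- A function of slope one at infinity which is close to the linear function of slope `e` at
arbitrarily large scales, and has difference quotients as large as those of the linear function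
of slope `f`, must have `e = f`, provided the slope one is not attained near the inner
boundary. -/
lemma slopes_eq_of_gap {n : ℕ} {u : Euc n → ℝ} {e f : Euc n} (he : ‖e‖ = 1) (hf : ‖f‖ = 1)
    {r η : ℝ} (hη0 : 0 < η) (hη1 : η ≤ 1)
    (hcont : ContinuousOn u {x | r - 3 ≤ ‖x‖})
    (hlip : ∀ z, r ≤ ‖z‖ → ∀ x y, ‖x - z‖ ≤ 3 → ‖y - z‖ ≤ 3 → u x - u y ≤ ‖x - y‖)
    (hup : ∀ y ε, r ≤ ‖y‖ → 0 < ε → ε ≤ 1 / 2 → ∀ y₁, ‖y₁ - y‖ ≤ ε →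
      ∃ Y, ‖Y - y‖ ≤ 2 * ε ∧ 2 * u y₁ ≤ u y + u Y)
    (hdn : ∀ y ε, r ≤ ‖y‖ → 0 < ε → ε ≤ 1 / 2 → ∀ y₁, ‖y₁ - y‖ ≤ ε →
      ∃ Y, ‖Y - y‖ ≤ 2 * ε ∧ u y + u Y ≤ 2 * u y₁)
    (hgap : ∀ y z, r ≤ ‖z‖ → ‖z‖ ≤ r + 1 → ‖y - z‖ ≤ 1 → u y - u z ≤ (1 - η) * ‖y - z‖)
    (hstart : ∀ b, b ≠ 0 → ∀ μ, 0 < μ → ∃ x, r ≤ ‖x‖ ∧ ⟪f, b⟫ - μ ≤ u (x + b) - u x)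
    (happrox : ∀ ℓ : ℝ, 0 < ℓ → ∀ R₁, ∃ R, R₁ ≤ R ∧ ∀ x, r ≤ ‖x‖ → ‖x‖ ≤ R →
      |u x - ⟪e, x⟫| ≤ ℓ * R) : e = f := by
  by_contra hne
  obtain ⟨c, hc⟩ : ∃ c, c = (1 - ⟪f, e⟫) / 4 := ⟨_, rfl⟩
  have hfe : ⟪f, e⟫ < 1 := (inner_lt_one_iff_real_of_norm_eq_one hf he).2 (Ne.symm hne)
  have hfe' : -1 ≤ ⟪f, e⟫ := by
    have := abs_le.1 (abs_real_inner_le_norm f e)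
    rw [hf, he] at this; linarith
  have hc0 : 0 < c := by rw [hc]; linarith
  have hc1 : c ≤ 1 := by rw [hc]; linarith
  obtain ⟨κ, hκ⟩ : ∃ κ, κ = c / 6 := ⟨_, rfl⟩
  have hκ0 : 0 < κ := by rw [hκ]; linarith
  obtain ⟨h, hh, hh1, hhc, hhη⟩ : ∃ h : ℝ, 0 < h ∧ h ≤ 1 / 40 ∧ h ≤ c / 10 ∧ h ≤ η / 10 :=
    ⟨min (1 / 40) (min (c / 10) (η / 10)), by positivity, min_le_left _ _,
      (min_le_right _ _).trans (min_le_left _ _), (min_le_right _ _).trans (min_le_right _ _)⟩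
  have hhe : ‖h • e‖ = h := by rw [norm_smul, he, Real.norm_of_nonneg hh.le, mul_one]
  have hhcpos : 0 < h * c := mul_pos hh hc0
  set d : Euc n := (2 / 5 : ℝ) • f - h • e with hd
  have hf25 : ‖(2 / 5 : ℝ) • f‖ = 2 / 5 := by
    rw [norm_smul, hf, Real.norm_of_nonneg (by norm_num), mul_one]
  have hd1 : ‖d‖ ≤ 1 := by
    refine (norm_sub_le _ _).trans ?_
    rw [hf25, hhe]; linarith
  have hd0 : d ≠ 0 := by
    intro h0
    have := norm_sub_norm_le ((2 / 5 : ℝ) • f) (h • e)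
    rw [← hd, h0, norm_zero, hf25, hhe] at this
    linarith
  obtain ⟨x₁, hx₁, hx₁d⟩ := hstart d hd0 (h * c) hhcpos
  have hfd : ⟪f, d⟫ = 2 / 5 - h + 4 * (h * c) := by
    rw [hd, inner_sub_right, inner_smul_right, inner_smul_right, real_inner_self_eq_norm_sq, hf,
      hc]; ring
  obtain ⟨ℓ, hℓ⟩ : ∃ ℓ, ℓ = κ ^ 2 / 40000 := ⟨_, rfl⟩
  have hℓ0 : 0 < ℓ := by rw [hℓ]; positivity
  obtain ⟨R, hR₁, hRapp⟩ := happrox ℓ hℓ0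
    (1 + ‖x₁‖ + 16 * ‖x₁‖ ^ 2 / c + 34 / κ)
  have t1 := norm_nonneg x₁
  have t2 : 0 ≤ 16 * ‖x₁‖ ^ 2 / c := by positivity
  have t3 : 0 ≤ 34 / κ := by positivity
  have hR1 : 1 ≤ R := by linarith
  have hR0 : 0 < R := by linarith
  obtain ⟨a, ha⟩ : ∃ a, a = 20000 / κ ^ 2 * h / R ^ 2 := ⟨_, rfl⟩
  obtain ⟨g, hg⟩ : ∃ g, g = 16 * h / R ^ 2 := ⟨_, rfl⟩
  have ha0 : 0 ≤ a := by rw [ha]; positivity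
  have hg0 : 0 ≤ g := by rw [hg]; positivity
  obtain ⟨ε, hε, hε1, hε2, hε3, hε4⟩ : ∃ ε : ℝ, 0 < ε ∧ ε ≤ 1 / 10 ∧ 2 * ε ≤ h * c / 2 ∧
      ε ≤ ℓ * R ∧ ((5 / 4 + g) * ε ≤ κ ^ 2 / 1000 ∧ (5 / 4 + g) * ε ≤ h / (180 * R ^ 2)) := by
    have hev : ∀ {F : ℝ → ℝ} {C : ℝ}, Continuous F → F 0 < C → ∀ᶠ ε in 𝓝[>] (0 : ℝ), F ε ≤ C :=
      fun hF h0 => ((hF.tendsto 0).mono_left nhdsWithin_le_nhds).eventually_le_const h0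
    have := (self_mem_nhdsWithin : Ioi (0 : ℝ) ∈ 𝓝[>] 0)
    have E1 := hev (F := fun ε => ε) (C := 1 / 10) (by fun_prop) (by norm_num)
    have E2 := hev (F := fun ε => 2 * ε) (C := h * c / 2) (by fun_prop) (by simp; positivity)
    have E3 := hev (F := fun ε => ε) (C := ℓ * R) (by fun_prop) (by positivity)
    have E4 := hev (F := fun ε => (5 / 4 + g) * ε) (C := κ ^ 2 / 1000) (by fun_prop)
      (by simp; positivity)
    have E5 := hev (F := fun ε => (5 / 4 + g) * ε) (C := h / (180 * R ^ 2)) (by fun_prop)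
      (by simp; positivity)
    obtain ⟨ε, ⟨h1, h2, h3, h4, h5⟩, h0⟩ :=
      ((E1.and (E2.and (E3.and (E4.and E5)))).and this).exists
    exact ⟨ε, h0, h1, h2, h3, h4, h5⟩
  -- the penalised value at the starting pair
  have hx₁R : g * ‖x₁‖ ^ 2 ≤ h * c := by
    have h1 : 16 * ‖x₁‖ ^ 2 / c ≤ R ^ 2 := by nlinarith
    rw [div_le_iff₀ hc0] at h1
    rw [hg, div_mul_eq_mul_div, div_le_iff₀ (by positivity)]
    linarith [mul_le_mul_of_nonneg_left h1 hh.le]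
  have hstartK : (x₁ + d, x₁, x₁ + d, x₁) ∈ doubledDomain n r R ε :=
    ⟨hx₁, by linarith, by simpa using hd1, by simpa using hε.le, by simpa using hε.le⟩
  have hstartval : 1 / 5 - h + 2 * (h * c)
      ≤ doubled e (h • e) (5 / 4) a g (x₁ + d) x₁ (u (x₁ + d)) (u x₁) := by
    have : x₁ + d - x₁ + h • e = (2 / 5 : ℝ) • f := by rw [hd]; abel
    rw [doubled, this, hf25]
    linarith [mul_nonneg ha0 (sq_nonneg (u x₁ - ⟪e, x₁⟫))]
  obtain ⟨⟨y, z, y₁, z₁⟩, ⟨hz1, hz2, hyz, hy₁, hz₁⟩, hmax⟩ :=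
    exists_doubled_max (by linarith) hcont e (h • e) (5 / 4) a g ⟨_, hstartK⟩
  have hval := hstartval.trans (hmax _ hstartK)
  simp only at hz1 hz2 hyz hy₁ hz₁ hval hmax
  have hLy : u y₁ ≤ u y + ε := by
    have h1 : ‖y₁ - z‖ ≤ 3 := by
      have := norm_add_le (y₁ - y) (y - z)
      rw [sub_add_sub_cancel] at this; linarith
    linarith [hlip z hz1 y₁ y h1 (by linarith)]
  have hLz : u z ≤ u z₁ + ε ∧ u z₁ ≤ u z + ε := by
    have h1 := hlip z hz1 z₁ z (by linarith) (by simp)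
    have h2 := hlip z hz1 z z₁ (by simp) (by linarith)
    rw [norm_sub_rev] at h2
    constructor <;> linarith
  have hw : |u z₁ - ⟪e, z⟫| ≤ 2 * ℓ * R := by
    have := abs_le.1 (hRapp z hz1 hz2)
    rw [abs_le]; constructor <;> linarith [hLz.1, hLz.2]
  have haw1 : |2 * a * (u z₁ - ⟪e, z⟫)| ≤ 2 * h / R := by
    rw [abs_mul, abs_of_nonneg (by positivity : 0 ≤ 2 * a)]
    calc _ ≤ 2 * a * (2 * ℓ * R) := by gcongr
      _ = 2 * h / R := by rw [ha, hℓ]; field_simp; norm_num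
  have haw2 : a * (u z₁ - ⟪e, z⟫) ^ 2 ≤ h * c / 2 := by
    calc a * (u z₁ - ⟪e, z⟫) ^ 2 = a * |u z₁ - ⟪e, z⟫| ^ 2 := by rw [sq_abs]
      _ ≤ a * (2 * ℓ * R) ^ 2 := by gcongr
      _ = h * c * (c / 720000) := by rw [ha, hℓ, hκ]; field_simp; norm_num
      _ ≤ h * c * (1 / 2) := by gcongr; linarith
      _ = h * c / 2 := by ring
  obtain ⟨l1, l2, l3⟩ := doubled_large_location he hh hc0 hη0 hη1 hhη hR0 hg hε2 y z y₁ z₁ haw2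
    hLy hLz.1 (hlip z hz1 y z (by linarith) (by simp))
    (fun h1 => hgap y z hz1 h1 hyz) hval
  have hyz' : ‖y - z‖ ≤ 3 / 4 := by
    have h1 := norm_sub_le (y - z + h • e) (h • e)
    rw [add_sub_cancel_right, hhe] at h1
    have := (separation_of_long he hh hh1 hc0 hhc (v := y - z + h • e) (by simpa using l3)).2.1
    linarith
  have hy : r ≤ ‖y‖ := by
    have := norm_le_norm_sub_add z y
    rw [norm_sub_rev] at this; linarith
  obtain ⟨Y, hY, huY⟩ := hup y ε hy hε (by linarith) y₁ hy₁
  obtain ⟨Z, hZ, huZ⟩ := hdn z ε hz1 hε (by linarith) z₁ hz₁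
  refine doubled_no_local_max he hh hh1 hc0 hhc hc1 hR0 hε hκ ha hg ?_ hε4.1 hε4.2 y z y₁ z₁ Y Z
    hz2 haw1 l3 ?_ hy₁ hz₁ hY huY hZ huZ
  · have h1 : 34 / κ ≤ R := by linarith [t2]
    rw [div_le_iff₀ hκ0] at h1
    rw [div_le_iff₀ hR0]
    have : 34 * h ≤ 34 * (1 / 40) := by linarith
    linarith
  · intro y' z' y₁' z₁' m1 m2 m3 m4
    refine hmax (y', z', y₁', z₁') ⟨?_, ?_, ?_, m3, m4⟩
    · have := norm_le_norm_sub_add z z'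
      rw [norm_sub_rev] at this
      simp only; linarith
    · have := norm_le_norm_sub_add z' z
      simp only; linarith
    · have h1 : y' - z' = (y' - y) + (y - z) - (z' - z) := by abel
      have h2 := norm_sub_le ((y' - y) + (y - z)) (z' - z)
      have h3 := norm_add_le (y' - y) (y - z)
      simp only; rw [h1]; linarith

/-- Comparison with cones up to the inner boundary. -/
lemma CmpAbove.le_cone {n : ℕ} {A : Set (Euc n)} {u : Euc n → ℝ} (hA : IsClosed A)
    (hu : ContinuousOn u (closure Aᶜ)) (hcmp : CmpAbove Aᶜ u) {W : Set (Euc n)}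
    (hW : IsOpen W) (hWb : IsBounded W) {x₀ : Euc n} {a b : ℝ}
    (hin : ∀ x ∈ frontier Aᶜ, x ∈ closure W → u x ≤ a * ‖x - x₀‖ + b)
    (hpole : x₀ ∈ Aᶜ → x₀ ∈ W → u x₀ ≤ b)
    (hout : ∀ x ∈ Aᶜ, x ∈ frontier W → u x ≤ a * ‖x - x₀‖ + b) :
    ∀ x ∈ Aᶜ, x ∈ W → u x ≤ a * ‖x - x₀‖ + b := by
  intro x₁ hx₁ hx₁W
  by_contra! hlt
  obtain ⟨δ, hδ⟩ : ∃ δ, δ = (u x₁ - (a * ‖x₁ - x₀‖ + b)) / 2 := ⟨_, rfl⟩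
  have hδ0 : 0 < δ := by rw [hδ]; linarith
  have hcont : ContinuousOn (fun x => u x - (a * ‖x - x₀‖ + b)) (closure Aᶜ) :=
    hu.sub (by fun_prop)
  set V : Set (Euc n) := (Aᶜ ∩ W) ∩ (fun x => u x - (a * ‖x - x₀‖ + b)) ⁻¹' Ioi δ with hV
  have hVo : IsOpen V := (hcont.mono (inter_subset_left.trans subset_closure)).isOpen_inter_preimage
    (hA.isOpen_compl.inter hW) isOpen_Ioi
  have hVcl : closure V ⊆ closure Aᶜ ∩ (fun x => u x - (a * ‖x - x₀‖ + b)) ⁻¹' Ici δ := by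
    refine closure_minimal ?_ (hcont.preimage_isClosed_of_isClosed isClosed_closure isClosed_Ici)
    rintro x ⟨⟨h1, -⟩, h2⟩
    exact ⟨subset_closure h1, le_of_lt (show δ < u x - (a * ‖x - x₀‖ + b) from h2)⟩
  have hVW : closure V ⊆ closure W := closure_mono fun x hx => hx.1.2
  have hVA : closure V ⊆ Aᶜ := by
    intro x hx
    by_contra hxA
    have hfr : x ∈ frontier Aᶜ := by
      rw [frontier, hA.isOpen_compl.interior_eq]
      exact ⟨(hVcl hx).1, hxA⟩
    have h1 := hin x hfr (hVW hx)
    have h2 : δ ≤ u x - (a * ‖x - x₀‖ + b) := (hVcl hx).2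
    linarith
  have hx₀V : x₀ ∉ V := by
    rintro ⟨⟨h1, h2⟩, h3⟩
    have h3' : δ < u x₀ - (a * ‖x₀ - x₀‖ + b) := h3
    rw [sub_self, norm_zero] at h3'
    linarith [hpole h1 h2]
  have hmem : x₁ ∈ V := ⟨⟨hx₁, hx₁W⟩, by simp only [mem_preimage, mem_Ioi]; linarith⟩
  have := hcmp V hVo (hWb.subset fun x hx => hx.1.2) hVA x₀ a (b + δ) ?_ x₁ hmem
  · linarith
  rw [sdiff_singleton_eq_self hx₀V, hVo.frontier_eq]
  rintro x ⟨hxc, hxV⟩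
  by_cases hxW : x ∈ W
  · by_contra! hgt
    exact hxV ⟨⟨hVA hxc, hxW⟩, by simp only [mem_preimage, mem_Ioi]; linarith⟩
  · have := hout x (hVA hxc) (by rw [hW.frontier_eq]; exact ⟨hVW hxc, hxW⟩)
    linarith

/-- Infinity harmonic functions in the complement of a subset of the unit ball, of slope one at
infinity in both directions. -/
structure Normalized {n : ℕ} (A : Set (Euc n)) (u : Euc n → ℝ) (M : ℝ) : Prop where
  closed : IsClosed A
  subset : A ⊆ ball 0 1
  zero_mem : (0 : Euc n) ∈ A
  cont : ContinuousOn u (closure Aᶜ)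
  above : CmpAbove Aᶜ u
  below : CmpAbove Aᶜ (fun x => -u x)
  bdry : ∀ x ∈ frontier Aᶜ, |u x| ≤ M
  nonneg : 0 ≤ M
  growth : ∀ δ : ℝ, 0 < δ → ∃ R, ∀ x, R ≤ ‖x‖ → |u x| ≤ (1 + δ) * ‖x‖
  large : ∀ δ : ℝ, 0 < δ → ∀ᶠ r : ℝ in atTop, ∃ x, ‖x‖ = r ∧ (1 - δ) * r ≤ u x
  small : ∀ δ : ℝ, 0 < δ → ∀ᶠ r : ℝ in atTop, ∃ x, ‖x‖ = r ∧ (1 - δ) * r ≤ -u x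

namespace Normalized

variable {n : ℕ} {A : Set (Euc n)} {u : Euc n → ℝ} {M : ℝ}

lemma neg (H : Normalized A u M) : Normalized A (fun x => -u x) M where
  closed := H.closed
  subset := H.subset
  zero_mem := H.zero_mem
  cont := H.cont.neg
  above := H.below
  below := by simpa using H.above
  bdry := by simpa using H.bdry
  nonneg := H.nonneg
  growth := by simpa using H.growth
  large := H.small
  small := by simpa using H.large

lemma mem_compl (H : Normalized A u M) {x : Euc n} (hx : 1 ≤ ‖x‖) : x ∈ Aᶜ := fun h => by
  have := H.subset h
  rw [mem_ball_zero_iff] at this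
  linarith

lemma norm_frontier_le (H : Normalized A u M) {x : Euc n} (hx : x ∈ frontier Aᶜ) : ‖x‖ ≤ 1 := by
  rw [frontier_compl] at hx
  have := H.subset (H.closed.frontier_subset hx)
  rw [mem_ball_zero_iff] at this
  exact this.le

lemma le_of_growth (H : Normalized A u M) {x : Euc n} (hx : x ∈ Aᶜ) : u x ≤ M + ‖x‖ := by
  have key : ∀ δ : ℝ, 0 < δ → u x ≤ (1 + δ) * ‖x‖ + M := by
    intro δ hδ
    obtain ⟨R, hR⟩ := H.growth δ hδ
    have := H.above.le_cone H.closed H.cont (W := ball 0 (max R (‖x‖ + 1))) isOpen_ball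
      isBounded_ball (x₀ := 0) (a := 1 + δ) (b := M) ?_ (fun h => absurd H.zero_mem h) ?_ x hx
      (by rw [mem_ball_zero_iff]; exact lt_of_lt_of_le (by linarith) (le_max_right _ _))
    · simpa using this
    · intro y hy _
      have := (abs_le.1 (H.bdry y hy)).2
      have : 0 ≤ (1 + δ) * ‖y - 0‖ := by positivity
      linarith
    · intro y _ hy
      have hy' := frontier_ball_subset_sphere hy
      rw [mem_sphere_zero_iff_norm] at hy'
      have := (abs_le.1 (hR y (hy' ▸ le_max_left _ _))).2
      rw [sub_zero]
      linarith [H.nonneg]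
  refine le_of_forall_pos_le_add fun ε hε => ?_
  have h := key (ε / (‖x‖ + 1)) (by positivity)
  have h2 : ε / (‖x‖ + 1) * ‖x‖ ≤ ε := by
    rw [div_mul_eq_mul_div, div_le_iff₀ (by positivity)]
    nlinarith [norm_nonneg x]
  linarith

/-- The cone of slope one with pole `y` lies above `u`. -/
lemma le_cone (H : Normalized A u M) {y : Euc n} (hM : M ≤ u y + (‖y‖ - 1))
    {x : Euc n} (hx : x ∈ Aᶜ) : u x ≤ u y + ‖x - y‖ := by
  have key : ∀ δ : ℝ, 0 < δ → u x ≤ (1 + 2 * δ) * ‖x - y‖ + u y := by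
    intro δ hδ
    obtain ⟨R, hR⟩ := H.growth δ hδ
    obtain ⟨T, hT⟩ : ∃ T, T = max (max (R + ‖y‖) (‖x - y‖ + 1))
      (((1 + δ) * ‖y‖ - u y) / δ) := ⟨_, rfl⟩
    have hT1 : R + ‖y‖ ≤ T := by rw [hT]; exact (le_max_left _ _).trans (le_max_left _ _)
    have hT2 : ‖x - y‖ + 1 ≤ T := by rw [hT]; exact (le_max_right _ _).trans (le_max_left _ _)
    have hT3 : (1 + δ) * ‖y‖ - u y ≤ T * δ := by
      rw [← div_le_iff₀ hδ, hT]; exact le_max_right _ _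
    refine H.above.le_cone H.closed H.cont (W := ball y T) isOpen_ball
      isBounded_ball (x₀ := y) (a := 1 + 2 * δ) (b := u y) ?_ (fun _ _ => le_rfl) ?_ x hx
      (by rw [mem_ball_iff_norm]; linarith)
    · intro p hp _
      have h1 := (_root_.abs_le.1 (H.bdry p hp)).2
      have h2 := H.norm_frontier_le hp
      have h3 := norm_sub_norm_le y p
      rw [norm_sub_rev] at h3
      have : 0 ≤ 2 * δ * ‖p - y‖ := by positivity
      linarith
    · intro p _ hp
      have hp' := frontier_ball_subset_sphere hp
      rw [mem_sphere_iff_norm] at hp'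
      have h4 := norm_sub_norm_le (p - y) (-y)
      rw [sub_neg_eq_add, sub_add_cancel, norm_neg] at h4
      have h1 := (_root_.abs_le.1 (hR p (by linarith))).2
      have h3 := norm_le_norm_sub_add p y
      have h5 : (1 + δ) * ‖p‖ ≤ (1 + δ) * (‖p - y‖ + ‖y‖) := by gcongr
      rw [hp'] at h5 ⊢
      linarith
  refine le_of_forall_pos_le_add fun ε hε => ?_
  have h := key (ε / (2 * (‖x - y‖ + 1))) (by positivity)
  have h2 : 2 * (ε / (2 * (‖x - y‖ + 1))) * ‖x - y‖ ≤ ε := by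
    have : 2 * (ε / (2 * (‖x - y‖ + 1))) * ‖x - y‖ = ε * ‖x - y‖ / (‖x - y‖ + 1) := by
      field_simp
    rw [this, div_le_iff₀ (by positivity)]
    nlinarith [norm_nonneg (x - y)]
  linarith

/-- Away from the inner boundary, `u` is a contraction along segments. -/
lemma sub_le_of_segment (H : Normalized A u M) {x y : Euc n}
    (hseg : ∀ z ∈ segment ℝ y x, M + 1 ≤ ‖z‖) : u x - u y ≤ ‖x - y‖ := by
  have hM := H.nonneg
  have hmem : ∀ z ∈ segment ℝ y x, z ∈ Aᶜ := fun z hz => H.mem_compl (by linarith [hseg z hz])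
  have hx := right_mem_segment ℝ y x
  have hy := left_mem_segment ℝ y x
  have hx1 := hseg x hx
  have hy1 := hseg y hy
  rcases le_total 0 (u y) with h | h
  · linarith [H.le_cone (y := y) (by linarith) (hmem x hx)]
  rcases le_total (u x) 0 with h' | h'
  · have := H.neg.le_cone (y := x) (by linarith) (hmem y hy)
    rw [norm_sub_rev] at this
    linarith
  have hc : ContinuousOn u (segment ℝ y x) :=
    H.cont.mono fun z hz => subset_closure (hmem z hz)
  obtain ⟨z, hz, hz0⟩ := (convex_segment (𝕜 := ℝ) y x).isPreconnected.intermediate_value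
    hy hx hc ⟨h, h'⟩
  have hz1 := hseg z hz
  have h1 := H.le_cone (y := z) (by linarith) (hmem x hx)
  have h2 := H.neg.le_cone (y := z) (by linarith) (hmem y hy)
  have h3 := dist_add_dist_of_mem_segment hz
  rw [dist_eq_norm, dist_eq_norm, dist_eq_norm, norm_sub_rev z x, norm_sub_rev y x] at h3
  linarith

lemma sub_le_coarse (H : Normalized A u M) {x y : Euc n} (hx : x ∈ Aᶜ) (hy : y ∈ Aᶜ) :
    u x - u y ≤ ‖x - y‖ + (4 * M + 2) := by
  by_cases h : ∀ z ∈ segment ℝ y x, M + 1 ≤ ‖z‖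
  · linarith [H.sub_le_of_segment h, H.nonneg]
  push Not at h
  obtain ⟨z, hz, hz1⟩ := h
  have h3 := dist_add_dist_of_mem_segment hz
  rw [dist_eq_norm, dist_eq_norm, dist_eq_norm, norm_sub_rev z x, norm_sub_rev y x] at h3
  have h4 := norm_le_norm_sub_add x z
  have h5 := norm_le_norm_sub_add y z
  have h6 := H.le_of_growth hx
  have h7 := H.neg.le_of_growth hy
  linarith

end Normalized

lemma norm_sub_le_of_norm_eq {n : ℕ} {x p : Euc n} {T : ℝ} (hT : 0 < T) (hp : ‖p‖ = T) :
    ‖x - p‖ ≤ T - ⟪p, x⟫ / T + ‖x‖ ^ 2 / (2 * T) := by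
  have h : T - ⟪p, x⟫ / T + ‖x‖ ^ 2 / (2 * T) = (‖x - p‖ ^ 2 + T ^ 2) / (2 * T) := by
    rw [norm_sub_sq_real, hp, real_inner_comm]; field_simp; ring
  rw [h, le_div_iff₀ (by positivity)]
  linarith [sq_nonneg (‖x - p‖ - T)]

/-- `e` is the slope of a blow-down of `u`. -/
def IsBlowdown {n : ℕ} (A : Set (Euc n)) (u : Euc n → ℝ) (e : Euc n) : Prop :=
  ∀ ℓ : ℝ, 0 < ℓ → ∀ R₁ : ℝ, ∃ R, R₁ ≤ R ∧ ∀ x ∈ Aᶜ, ‖x‖ ≤ R → |u x - ⟪e, x⟫| ≤ ℓ * R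

namespace Normalized

variable {n : ℕ} {A : Set (Euc n)} {u : Euc n → ℝ} {M : ℝ}

lemma linear_le (H : Normalized A u M) {p x : Euc n} {T D : ℝ} (hT : 1 ≤ T) (hp : ‖p‖ = T)
    (hup : T - D ≤ u p) (hx : x ∈ Aᶜ) :
    ⟪p, x⟫ / T - ‖x‖ ^ 2 / (2 * T) - D - (4 * M + 2) ≤ u x := by
  have h1 := H.sub_le_coarse (H.mem_compl (x := p) (by linarith)) hx
  have h2 := norm_sub_le_of_norm_eq (x := x) (by linarith) hp
  rw [norm_sub_rev] at h1
  linarith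

/-- At large scales `u` is close to a linear function of slope one. -/
lemma exists_approx_linear (H : Normalized A u M) {ℓ : ℝ} (hℓ : 0 < ℓ) :
    ∀ᶠ R : ℝ in atTop, ∃ e : Euc n, ‖e‖ = 1 ∧
      ∀ x ∈ Aᶜ, ‖x‖ ≤ R → |u x - ⟪e, x⟫| ≤ ℓ * R := by
  obtain ⟨C, hC⟩ : ∃ C, C = 4 * M + 2 := ⟨_, rfl⟩
  have hC0 : 0 < C := by rw [hC]; linarith [H.nonneg]
  obtain ⟨δ, hδ⟩ : ∃ δ, δ = ℓ ^ 2 / 256 := ⟨_, rfl⟩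
  have hδ0 : 0 < δ := by rw [hδ]; positivity
  have hT : Tendsto (fun R : ℝ => 2 / ℓ * R) atTop atTop :=
    tendsto_id.const_mul_atTop (by positivity)
  filter_upwards [hT.eventually (H.large δ hδ0), hT.eventually (H.small δ hδ0),
    hT.eventually_ge_atTop 1, hT.eventually_ge_atTop (128 * C / ℓ ^ 2),
    eventually_ge_atTop (4 * C / ℓ)] with R ⟨p, hp, hup⟩ ⟨q, hq, huq⟩ hT1 hT2 hR
  obtain ⟨T, hTR⟩ : ∃ T, T = 2 / ℓ * R := ⟨_, rfl⟩
  rw [← hTR] at hp hup hq huq hT1 hT2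
  have hR' : R = T * ℓ / 2 := by rw [hTR]; field_simp
  rw [div_le_iff₀ hℓ] at hR
  rw [div_le_iff₀ (by positivity)] at hT2
  have hT0 : 0 < T := by linarith
  have hR0 : 0 < R := by rw [hR']; positivity
  have hpq := H.sub_le_coarse (H.mem_compl (x := p) (by linarith)) (H.mem_compl (x := q)
    (by linarith))
  rw [← hC] at hpq
  have hsum : ‖p + q‖ ≤ ℓ / 4 * T := by
    have h1 : ‖p + q‖ ^ 2 + ‖p - q‖ ^ 2 = 4 * T ^ 2 := by
      have := parallelogram_law_with_norm ℝ p q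
      rw [hp, hq] at this
      linarith
    have h2 : 0 ≤ ‖p - q‖ := norm_nonneg _
    have h2' : ‖p - q‖ ≤ 2 * T := by
      have := norm_sub_le p q
      rw [hp, hq] at this; linarith
    have h3 : 2 * T - (2 * δ * T + C) ≤ ‖p - q‖ := by linarith
    have h4 : ‖p + q‖ ^ 2 ≤ 4 * T * (2 * δ * T + C) := by
      linarith [mul_le_mul_of_nonneg_left h3 (by positivity : 0 ≤ 4 * T),
        sq_nonneg (2 * T - ‖p - q‖)]
    have h5 : 2 * δ * T + C ≤ ℓ ^ 2 / 64 * T := by rw [hδ]; linarith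
    have h6 : ‖p + q‖ ^ 2 ≤ (ℓ / 4 * T) ^ 2 := by
      have := mul_le_mul_of_nonneg_left h5 (by positivity : 0 ≤ 4 * T)
      linarith
    exact (sq_le_sq₀ (norm_nonneg _) (by positivity)).1 h6
  refine ⟨T⁻¹ • p, ?_, fun x hx hxR => ?_⟩
  · rw [norm_smul, norm_inv, hp, Real.norm_of_nonneg hT0.le, inv_mul_cancel₀ hT0.ne']
  rw [inner_smul_left]
  simp only [conj_trivial]
  have hx2 : ‖x‖ ^ 2 / (2 * T) ≤ ℓ / 4 * R := by
    rw [div_le_iff₀ (by positivity)]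
    calc ‖x‖ ^ 2 ≤ R ^ 2 := by gcongr
      _ = ℓ / 4 * R * (2 * T) := by rw [hR']; ring
  have hδT : δ * T ≤ ℓ / 4 * R := by
    rw [hR', hδ]
    have : 0 ≤ ℓ ^ 2 * T := by positivity
    linarith
  have h1 := H.linear_le (D := δ * T) hT1 hp (by linarith) hx
  have h2 := H.neg.linear_le (D := δ * T) hT1 hq (by linarith) hx
  have h3 : -⟪q, x⟫ / T ≤ ⟪p, x⟫ / T + ℓ / 4 * R := by
    have : ⟪p + q, x⟫ ≥ -(ℓ / 4 * T * R) := by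
      have h4 := (_root_.abs_le.1 (abs_real_inner_le_norm (p + q) x)).1
      have h5 : ‖p + q‖ * ‖x‖ ≤ ℓ / 4 * T * R := by gcongr
      linarith
    rw [inner_add_left] at this
    rw [div_le_iff₀ hT0, add_mul, div_mul_cancel₀ _ hT0.ne']
    linarith
  have h4 : T⁻¹ * ⟪p, x⟫ = ⟪p, x⟫ / T := by rw [div_eq_inv_mul]
  rw [neg_div] at h3
  rw [h4, _root_.abs_le]
  constructor <;> linarith

/-- A linear lower bound of slope one determines the blow-downs. -/
lemma blowdown_eq_of_linear_le {e f : Euc n} {C : ℝ} (H : Normalized A u M) (he : ‖e‖ = 1)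
    (hf : ‖f‖ = 1) (hle : ∀ x ∈ Aᶜ, ⟪f, x⟫ - C ≤ u x) (hB : IsBlowdown A u e) : e = f := by
  have hle1 : ⟪e, f⟫ ≤ 1 := by
    have := (_root_.abs_le.1 (abs_real_inner_le_norm e f)).2
    rwa [he, hf, one_mul] at this
  have : 1 ≤ ⟪e, f⟫ := by
    refine le_of_forall_pos_le_add fun ε hε => ?_
    obtain ⟨R, hR, hRx⟩ := hB (ε / 2) (by positivity) (max 1 (2 * C / ε))
    have hR1 := (le_max_left _ _).trans hR
    have hR2 := (le_max_right _ _).trans hR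
    rw [div_le_iff₀ hε] at hR2
    have hn : ‖R • f‖ = R := by
      rw [norm_smul, hf, Real.norm_of_nonneg (by linarith), mul_one]
    have hmem := H.mem_compl (x := R • f) (by linarith)
    have h1 := hle _ hmem
    have h2 := (_root_.abs_le.1 (hRx _ hmem hn.le)).2
    rw [inner_smul_right] at h1 h2
    rw [real_inner_self_eq_norm_sq, hf] at h1
    have h3 : 0 ≤ R * (⟪e, f⟫ + ε - 1) := by linarith
    linarith [nonneg_of_mul_nonneg_right h3 (by linarith : 0 < R)]
  exact (inner_eq_one_iff_of_norm_eq_one he hf).1 (le_antisymm hle1 this)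

end Normalized

namespace Normalized

variable {n : ℕ} {A : Set (Euc n)} {u : Euc n → ℝ} {M : ℝ}

lemma continuousOn_of_one_le (H : Normalized A u M) : ContinuousOn u {x | 1 ≤ ‖x‖} :=
  H.cont.mono fun _ hx => subset_closure (H.mem_compl hx)

/-- Comparison with the cone whose pole is the centre of a small ball. -/
lemma le_cone_of_sphere (H : Normalized A u M) {y : Euc n} (hy : 3 ≤ ‖y‖) {s a : ℝ}
    (hs : s ≤ 1) (hsph : ∀ x, ‖x - y‖ = s → u x ≤ u y + a * s) {x : Euc n}
    (hx : ‖x - y‖ ≤ s) : u x ≤ u y + a * ‖x - y‖ := by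
  rcases hx.eq_or_lt with h | h
  · rw [h]; exact hsph x h
  have hfar : ∀ p : Euc n, ‖p - y‖ ≤ s → 2 ≤ ‖p‖ := fun p hp => by
    have := norm_le_norm_sub_add y p
    rw [norm_sub_rev] at this; linarith
  have := H.above.le_cone H.closed H.cont (W := ball y s) isOpen_ball isBounded_ball
    (x₀ := y) (a := a) (b := u y) ?_ (fun _ _ => le_rfl) ?_ x
    (H.mem_compl (by linarith [hfar x hx])) (by rwa [mem_ball_iff_norm])
  · linarith
  · intro p hp hpW
    have h1 := closure_ball_subset_closedBall hpW
    rw [mem_closedBall_iff_norm] at h1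
    linarith [H.norm_frontier_le hp, hfar p h1]
  · intro p _ hp
    have h1 := frontier_ball_subset_sphere hp
    rw [mem_sphere_iff_norm] at h1
    rw [h1]; linarith [hsph p h1]

lemma exists_max_closedBall (H : Normalized A u M) {y : Euc n} (hy : 3 ≤ ‖y‖) {s : ℝ}
    (hs0 : 0 ≤ s) (hs : s ≤ 1) : ∃ Y, ‖Y - y‖ ≤ s ∧ ∀ x, ‖x - y‖ ≤ s → u x ≤ u Y := by
  have hsub : closedBall y s ⊆ {x : Euc n | 1 ≤ ‖x‖} := fun x hx => by
    rw [mem_closedBall_iff_norm] at hx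
    have := norm_le_norm_sub_add y x
    rw [norm_sub_rev] at this
    simp only [mem_ofPred_eq]; linarith
  obtain ⟨Y, hY, hmax⟩ := (isCompact_closedBall y s).exists_isMaxOn
    ⟨y, mem_closedBall_self hs0⟩ (H.continuousOn_of_one_le.mono hsub)
  exact ⟨Y, by rwa [mem_closedBall_iff_norm] at hY, fun x hx =>
    hmax (by rwa [mem_closedBall_iff_norm])⟩

lemma exists_two_mul_le_add (H : Normalized A u M) {y y₁ : Euc n} {ε : ℝ} (hy : 3 ≤ ‖y‖)
    (hε : 0 < ε) (hε1 : ε ≤ 1 / 2) (hy₁ : ‖y₁ - y‖ ≤ ε) :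
    ∃ Y, ‖Y - y‖ ≤ 2 * ε ∧ 2 * u y₁ ≤ u y + u Y := by
  obtain ⟨Y, hY, hmax⟩ := H.exists_max_closedBall hy (s := 2 * ε) (by linarith) (by linarith)
  refine ⟨Y, hY, ?_⟩
  have hYy : u y ≤ u Y := hmax y (by simpa using hε.le)
  have h1 := H.le_cone_of_sphere hy (s := 2 * ε) (a := (u Y - u y) / (2 * ε)) (by linarith)
    (fun x hx => by
      rw [div_mul_cancel₀ _ (by positivity)]
      linarith [hmax x hx.le]) (x := y₁) (by linarith)
  have h2 : (u Y - u y) / (2 * ε) * ‖y₁ - y‖ ≤ (u Y - u y) / (2 * ε) * ε := by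
    have : 0 ≤ (u Y - u y) / (2 * ε) := div_nonneg (by linarith) (by positivity)
    gcongr
  have h3 : (u Y - u y) / (2 * ε) * ε = (u Y - u y) / 2 := by field_simp
  linarith

/-- If the slope one is attained on the boundary of a unit ball, it is attained at all scales. -/
lemma exists_large_of_attained (H : Normalized A u M) {z y : Euc n} (hz : 2 * M + 3 ≤ ‖z‖)
    (huz : -1 ≤ u z) (hyz : ‖y - z‖ ≤ 1) (huy : 1 ≤ u y - u z) {T : ℝ} (hT : ‖z‖ + 1 ≤ T) :
    ∃ Y, ‖Y - z‖ = T ∧ u z + T ≤ u Y := by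
  by_contra! hcon
  have hM := H.nonneg
  have hT0 : 0 < T := by linarith [norm_nonneg z]
  have hout : ∀ Y : Euc n, ‖Y - z‖ = T → 1 ≤ ‖Y‖ := fun Y hY => by
    have := norm_sub_le Y z
    linarith
  obtain ⟨σ, hσ1, hσ2, hσ⟩ : ∃ σ : ℝ, 1 / 2 ≤ σ ∧ σ < 1 ∧
      ∀ Y, ‖Y - z‖ = T → u Y ≤ σ * T + u z := by
    rcases (sphere z T).eq_empty_or_nonempty with he | hne
    · refine ⟨1 / 2, le_rfl, by norm_num, fun Y hY => ?_⟩
      have : Y ∈ sphere z T := by rwa [mem_sphere_iff_norm]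
      rw [he] at this
      exact this.elim
    · obtain ⟨Y, hY, hmax⟩ := (isCompact_sphere z T).exists_isMaxOn hne
        (H.continuousOn_of_one_le.mono fun x hx => hout x (by rwa [mem_sphere_iff_norm] at hx))
      rw [mem_sphere_iff_norm] at hY
      refine ⟨max (1 / 2) ((u Y - u z) / T), le_max_left _ _, max_lt (by norm_num) ?_,
        fun x hx => ?_⟩
      · rw [div_lt_one hT0]; linarith [hcon Y hY]
      · have h1 : u x ≤ u Y := hmax (by rwa [mem_sphere_iff_norm])
        have h2 := (div_le_iff₀ hT0).1 (le_max_right (1 / 2) ((u Y - u z) / T))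
        linarith
  have hy1 : 1 ≤ ‖y‖ := by
    have := norm_le_norm_sub_add z y
    rw [norm_sub_rev] at this; linarith
  have := H.above.le_cone H.closed H.cont (W := ball z T) isOpen_ball isBounded_ball
    (x₀ := z) (a := σ) (b := u z) ?_ (fun _ _ => le_rfl) ?_ y (H.mem_compl hy1)
    (by rw [mem_ball_iff_norm]; linarith)
  · have : σ * ‖y - z‖ ≤ σ * 1 := by gcongr
    linarith
  · intro p hp _
    have h1 := (_root_.abs_le.1 (H.bdry p hp)).2
    have h2 := H.norm_frontier_le hp
    have h3 := norm_sub_norm_le z p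
    rw [norm_sub_rev] at h3
    have : 1 / 2 * (2 * M + 2) ≤ σ * ‖p - z‖ := by gcongr; linarith
    linarith
  · intro p _ hp
    have h1 := frontier_ball_subset_sphere hp
    rw [mem_sphere_iff_norm] at h1
    rw [h1]; exact hσ p h1

lemma exists_linear_le (H : Normalized A u M) {D : ℝ}
    (h : ∀ N : ℕ, ∃ p : Euc n, (N : ℝ) + 1 ≤ ‖p‖ ∧ ‖p‖ - D ≤ u p) :
    ∃ f : Euc n, ‖f‖ = 1 ∧ ∃ C, ∀ x ∈ Aᶜ, ⟪f, x⟫ - C ≤ u x := by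
  choose p hp hup using h
  have hp0 : ∀ N, 1 ≤ ‖p N‖ := fun N => by
    linarith [hp N, (Nat.cast_nonneg N : (0 : ℝ) ≤ N)]
  have hmem : ∀ N, ‖p N‖⁻¹ • p N ∈ sphere (0 : Euc n) 1 := fun N => by
    rw [mem_sphere_zero_iff_norm, norm_smul, norm_inv, norm_norm, inv_mul_cancel₀]
    linarith [hp0 N]
  obtain ⟨f, hf, φ, hφ, hlim⟩ := (isCompact_sphere (0 : Euc n) 1).tendsto_subseq hmem
  refine ⟨f, mem_sphere_zero_iff_norm.1 hf, D + (4 * M + 2), fun x hx => ?_⟩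
  have hinf : Tendsto (fun N => ‖p (φ N)‖) atTop atTop := by
    have : Tendsto (fun N => ‖p N‖) atTop atTop :=
      tendsto_atTop_mono (fun N => (by linarith [hp N] : (N : ℝ) ≤ ‖p N‖))
        tendsto_natCast_atTop_atTop
    exact this.comp hφ.tendsto_atTop
  have l1 : Tendsto (fun N => ⟪‖p (φ N)‖⁻¹ • p (φ N), x⟫) atTop (𝓝 ⟪f, x⟫) :=
    hlim.inner tendsto_const_nhds
  have l2 : Tendsto (fun N => ‖x‖ ^ 2 / (2 * ‖p (φ N)‖)) atTop (𝓝 0) :=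
    (hinf.const_mul_atTop (by norm_num : (0 : ℝ) < 2)).const_div_atTop _
  have l3 := ((l1.sub l2).sub_const D).sub_const (4 * M + 2)
  have := le_of_tendsto l3 (Eventually.of_forall fun N => by
    have := H.linear_le (hp0 (φ N)) rfl (hup (φ N)) hx
    rwa [inner_smul_left, conj_trivial, ← div_eq_inv_mul])
  linarith

lemma exists_linear_le_of_attained (H : Normalized A u M) {z y : Euc n} (hz : 2 * M + 3 ≤ ‖z‖)
    (huz : -1 ≤ u z) (hyz : ‖y - z‖ ≤ 1) (huy : 1 ≤ u y - u z) :
    ∃ f : Euc n, ‖f‖ = 1 ∧ ∃ C, ∀ x ∈ Aᶜ, ⟪f, x⟫ - C ≤ u x := by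
  refine H.exists_linear_le (D := ‖z‖ + 1) fun N => ?_
  obtain ⟨Y, hY, huY⟩ := H.exists_large_of_attained hz huz hyz huy (T := ‖z‖ + 1 + N)
    (by linarith [(Nat.cast_nonneg N : (0 : ℝ) ≤ N)])
  have h1 := norm_sub_le Y z
  have h2 := norm_le_norm_sub_add Y z
  exact ⟨Y, by linarith, by linarith⟩

/-- Either the slope one is not attained near a given sphere, or there is a linear bound of
slope one. -/
lemma gap_or_linear_le (H : Normalized A u M) {r : ℝ} (hr : 2 * M + 4 ≤ r) :
    (∃ η : ℝ, 0 < η ∧ η ≤ 1 ∧ ∀ y z : Euc n, r ≤ ‖z‖ → ‖z‖ ≤ r + 1 → ‖y - z‖ ≤ 1 →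
      u y - u z ≤ (1 - η) * ‖y - z‖) ∨
    (∃ f : Euc n, ‖f‖ = 1 ∧ ∃ C, ∀ x ∈ Aᶜ, ⟪f, x⟫ - C ≤ u x) ∨
    (∃ f : Euc n, ‖f‖ = 1 ∧ ∃ C, ∀ x ∈ Aᶜ, ⟪f, x⟫ - C ≤ -u x) := by
  have hM := H.nonneg
  set K : Set (Euc n × Euc n) := {p | r ≤ ‖p.2‖ ∧ ‖p.2‖ ≤ r + 1 ∧ ‖p.1 - p.2‖ ≤ 1} with hK
  have hnear : ∀ y z : Euc n, ‖y - z‖ ≤ 1 → ‖z‖ ≤ ‖y‖ + 1 := fun y z h => by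
    have := norm_le_norm_sub_add z y
    rw [norm_sub_rev] at this; linarith
  have hKc : IsCompact K := by
    apply Metric.isCompact_of_isClosed_isBounded
    · rw [hK]
      simp only [Set.ofPred_and]
      exact IsClosed.inter (isClosed_le (by fun_prop) (by fun_prop)) <|
        IsClosed.inter (isClosed_le (by fun_prop) (by fun_prop))
        (isClosed_le (by fun_prop) (by fun_prop))
    · refine (isBounded_iff_forall_norm_le).2 ⟨r + 2, ?_⟩
      rintro ⟨y, z⟩ ⟨-, h1, h2⟩
      simp only at h1 h2
      have a1 := norm_le_norm_sub_add y z
      simp only [Prod.norm_mk, max_le_iff]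
      constructor <;> linarith
  rcases K.eq_empty_or_nonempty with he | hne
  · refine Or.inl ⟨1, one_pos, le_rfl, fun y z h1 h2 h3 => ?_⟩
    have : (y, z) ∈ K := ⟨h1, h2, h3⟩
    rw [he] at this
    exact this.elim
  have c1 : ContinuousOn (fun p : Euc n × Euc n => u p.1) K :=
    H.continuousOn_of_one_le.comp (by fun_prop) fun p hp => by
      simp only [mem_ofPred_eq]
      linarith [hnear _ _ hp.2.2, hp.1]
  have c2 : ContinuousOn (fun p : Euc n × Euc n => u p.2) K :=
    H.continuousOn_of_one_le.comp (by fun_prop) fun p hp => by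
      simp only [mem_ofPred_eq]
      linarith [hp.1]
  obtain ⟨⟨y, z⟩, ⟨h1, h2, h3⟩, hmax⟩ := hKc.exists_isMaxOn hne (c1.sub c2)
  simp only at h1 h2 h3
  have hmax' : ∀ y' z' : Euc n, r ≤ ‖z'‖ → ‖z'‖ ≤ r + 1 → ‖y' - z'‖ ≤ 1 →
      u y' - u z' ≤ u y - u z := fun y' z' g1 g2 g3 => @hmax (y', z') ⟨g1, g2, g3⟩
  rcases lt_or_ge (u y - u z) 1 with hlt | hge
  · refine Or.inl ⟨min 1 (1 - (u y - u z)), lt_min one_pos (by linarith), min_le_left _ _,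
      fun y' z' g1 g2 g3 => ?_⟩
    have k1 := H.le_cone_of_sphere (y := z') (by linarith) (s := 1) (a := u y - u z) le_rfl
      (fun x hx => by linarith [hmax' x z' g1 g2 hx.le]) g3
    have k2 : (u y - u z) * ‖y' - z'‖ ≤ (1 - min 1 (1 - (u y - u z))) * ‖y' - z'‖ := by
      refine mul_le_mul_of_nonneg_right ?_ (norm_nonneg _)
      linarith [min_le_right 1 (1 - (u y - u z))]
    linarith
  · right
    rcases le_total (-1) (u z) with hz | hz
    · exact Or.inl (H.exists_linear_le_of_attained (by linarith) hz h3 hge)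
    · refine Or.inr (H.neg.exists_linear_le_of_attained (z := y) (y := z) ?_ ?_ ?_ ?_)
      · linarith [hnear y z h3]
      · have := H.sub_le_of_segment (x := y) (y := z) fun p hp => ?_
        · linarith
        · have k1 := dist_add_dist_of_mem_segment hp
          rw [dist_eq_norm, dist_eq_norm, dist_eq_norm, norm_sub_rev z y] at k1
          have k2 := norm_le_norm_sub_add z p
          linarith [norm_nonneg (p - y)]
      · rwa [norm_sub_rev]
      · linarith

end Normalized

lemma IsBlowdown.neg {n : ℕ} {A : Set (Euc n)} {u : Euc n → ℝ} {e : Euc n}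
    (h : IsBlowdown A u e) : IsBlowdown A (fun x => -u x) (-e) := by
  intro ℓ hℓ R₁
  obtain ⟨R, hR, hx⟩ := h ℓ hℓ R₁
  refine ⟨R, hR, fun x hxA hxR => ?_⟩
  have := hx x hxA hxR
  rw [inner_neg_left, ← abs_neg]
  convert this using 2
  ring

/-- The blow-down slope is approached by difference quotients far from the origin. -/
lemma IsBlowdown.exists_diff_ge {n : ℕ} {A : Set (Euc n)} {u : Euc n → ℝ} {f : Euc n}
    (h : IsBlowdown A u f) {r : ℝ} (hr : 1 ≤ r) (hA : ∀ x, r ≤ ‖x‖ → x ∈ Aᶜ)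
    {b : Euc n} (hb : b ≠ 0) {μ : ℝ} (hμ : 0 < μ) :
    ∃ x, r ≤ ‖x‖ ∧ ⟪f, b⟫ - μ ≤ u (x + b) - u x := by
  by_contra! hcon
  have hb0 : 0 < ‖b‖ := norm_pos_iff.2 hb
  set x : ℕ → Euc n := fun k => (r / ‖b‖ + k) • b with hx
  have hxn : ∀ k, ‖x k‖ = r + k * ‖b‖ := fun k => by
    rw [hx]
    simp only
    rw [norm_smul, Real.norm_of_nonneg (by positivity)]
    field_simp
  have hxr : ∀ k, r ≤ ‖x k‖ := fun k => by
    rw [hxn]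
    have : (0 : ℝ) ≤ k * ‖b‖ := by positivity
    linarith
  have hsucc : ∀ k, x (k + 1) = x k + b := fun k => by
    simp only [hx]; push_cast; rw [← add_assoc, add_smul _ 1, one_smul]
  have hiter : ∀ k : ℕ, u (x k) ≤ u (x 0) + k * (⟪f, b⟫ - μ) := by
    intro k
    induction k with
    | zero => simp
    | succ k ih =>
      have := hcon (x k) (hxr k)
      rw [hsucc]; push_cast; linarith
  obtain ⟨R, hR, hRx⟩ := h (μ / (8 * ‖b‖)) (by positivity) (2 * (r + ‖b‖))
  have hR0 : 0 < R := by linarith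
  set N := ⌊(R - r) / ‖b‖⌋₊ with hN
  have hN1 : N * ‖b‖ ≤ R - r := by
    rw [← le_div_iff₀ hb0]
    exact Nat.floor_le (div_nonneg (by linarith) hb0.le)
  have hN2 : R - r < (N + 1) * ‖b‖ := by
    rw [← div_lt_iff₀ hb0]
    exact Nat.lt_floor_add_one _
  have h0 := abs_le.1 (hRx (x 0) (hA _ (hxr 0)) (by rw [hxn]; simp; linarith))
  have h1 := abs_le.1 (hRx (x N) (hA _ (hxr N)) (by rw [hxn]; linarith))
  have hin : ⟪f, x N⟫ = ⟪f, x 0⟫ + N * ⟪f, b⟫ := by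
    simp only [hx]
    rw [inner_smul_right, inner_smul_right]; push_cast; ring
  have h2 : N * μ ≤ 2 * (μ / (8 * ‖b‖) * R) := by linarith [hiter N, h0.2, h1.1]
  have h3 : N * μ * ‖b‖ ≤ μ * R / 4 := by
    calc N * μ * ‖b‖ ≤ 2 * (μ / (8 * ‖b‖) * R) * ‖b‖ := by gcongr
      _ = μ * R / 4 := by field_simp; norm_num
  have h4 : μ * (R / 2) ≤ μ * (N * ‖b‖) := by gcongr; linarith
  have : 0 < μ * R := by positivity
  linarith

namespace Normalized

variable {n : ℕ} {A : Set (Euc n)} {u : Euc n → ℝ} {M : ℝ}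

lemma blowdown_unique (H : Normalized A u M) {e f : Euc n} (he : ‖e‖ = 1) (hf : ‖f‖ = 1)
    (hBe : IsBlowdown A u e) (hBf : IsBlowdown A u f) : e = f := by
  have hM := H.nonneg
  rcases H.gap_or_linear_le (r := 2 * M + 10) (by linarith) with
    ⟨η, hη0, hη1, hgap⟩ | ⟨d, hd, C, hC⟩ | ⟨d, hd, C, hC⟩
  · have hmem : ∀ x : Euc n, 2 * M + 10 ≤ ‖x‖ → x ∈ Aᶜ := fun x hx => H.mem_compl (by linarith)
    refine slopes_eq_of_gap he hf hη0 hη1 (H.continuousOn_of_one_le.mono fun x hx => ?_) ?_ ?_ ?_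
      hgap (fun b hb μ hμ => hBf.exists_diff_ge (by linarith) hmem hb hμ) fun ℓ hℓ R₁ => ?_
    · simp only [mem_ofPred_eq] at hx ⊢
      linarith
    · intro z hz x y hx hy
      refine H.sub_le_of_segment fun p hp => ?_
      have h1 := (convex_closedBall z 3).segment_subset
        (by rwa [mem_closedBall_iff_norm]) (by rwa [mem_closedBall_iff_norm]) hp
      rw [mem_closedBall_iff_norm] at h1
      have h2 := norm_le_norm_sub_add z p
      rw [norm_sub_rev] at h2
      linarith
    · intro y ε hy hε hε1 y₁ hy₁
      exact H.exists_two_mul_le_add (by linarith) hε hε1 hy₁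
    · intro y ε hy hε hε1 y₁ hy₁
      obtain ⟨Y, hY, huY⟩ := H.neg.exists_two_mul_le_add (by linarith) hε hε1 hy₁
      exact ⟨Y, hY, by linarith⟩
    · obtain ⟨R, hR, hx⟩ := hBe ℓ hℓ R₁
      exact ⟨R, hR, fun x h1 h2 => hx x (hmem x h1) h2⟩
  · rw [H.blowdown_eq_of_linear_le he hd hC hBe, H.blowdown_eq_of_linear_le hf hd hC hBf]
  · have h1 := H.neg.blowdown_eq_of_linear_le (by rwa [norm_neg]) hd hC hBe.neg
    have h2 := H.neg.blowdown_eq_of_linear_le (by rwa [norm_neg]) hd hC hBf.neg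
    exact neg_injective (h1.trans h2.symm)

end Normalized

lemma exists_subseq_blowdown {n : ℕ} {A : Set (Euc n)} {u : Euc n → ℝ} {R : ℕ → ℝ}
    {e : ℕ → Euc n} (hR : ∀ k : ℕ, (k : ℝ) + 1 ≤ R k) (he : ∀ k, ‖e k‖ = 1)
    (happ : ∀ k, ∀ x ∈ Aᶜ, ‖x‖ ≤ R k → |u x - ⟪e k, x⟫| ≤ 1 / ((k : ℝ) + 1) * R k) :
    ∃ f : Euc n, ‖f‖ = 1 ∧ IsBlowdown A u f ∧ ∀ ℓ : ℝ, 0 < ℓ → ∃ k, ∀ x ∈ Aᶜ, ‖x‖ ≤ R k →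
      |u x - ⟪f, x⟫| ≤ ℓ * R k := by
  obtain ⟨f, hf, φ, hφ, hlim⟩ := (isCompact_sphere (0 : Euc n) 1).tendsto_subseq
    (fun k => mem_sphere_zero_iff_norm.2 (he k))
  have hsum : Tendsto (fun k => 1 / ((φ k : ℝ) + 1) + ‖e (φ k) - f‖) atTop (𝓝 0) := by
    have h1 := (tendsto_one_div_add_atTop_nhds_zero_nat (𝕜 := ℝ)).comp hφ.tendsto_atTop
    have h2 := tendsto_iff_norm_sub_tendsto_zero.1 hlim
    simpa using h1.add h2
  have key : ∀ ℓ : ℝ, 0 < ℓ → ∀ᶠ k in atTop, ∀ x ∈ Aᶜ, ‖x‖ ≤ R (φ k) →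
      |u x - ⟪f, x⟫| ≤ ℓ * R (φ k) := by
    intro ℓ hℓ
    filter_upwards [hsum.eventually_le_const hℓ] with k hk x hxA hxR
    have h1 := happ (φ k) x hxA hxR
    have h2 : |⟪e (φ k) - f, x⟫| ≤ ‖e (φ k) - f‖ * R (φ k) :=
      (abs_real_inner_le_norm _ _).trans (by gcongr)
    have h3 : u x - ⟪f, x⟫ = (u x - ⟪e (φ k), x⟫) + ⟪e (φ k) - f, x⟫ := by
      rw [inner_sub_left]; ring
    have h4 : 0 ≤ R (φ k) := by
      linarith [hR (φ k), (Nat.cast_nonneg (φ k) : (0 : ℝ) ≤ (φ k : ℝ))]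
    rw [h3]
    refine (abs_add_le _ _).trans ?_
    linarith [mul_le_mul_of_nonneg_right hk h4]
  refine ⟨f, mem_sphere_zero_iff_norm.1 hf, fun ℓ hℓ R₁ => ?_, fun ℓ hℓ => ?_⟩
  · have hinf : Tendsto (fun k => R (φ k)) atTop atTop :=
      (tendsto_atTop_mono (fun N : ℕ => (by linarith [hR N] : (N : ℝ) ≤ R N))
        tendsto_natCast_atTop_atTop).comp hφ.tendsto_atTop
    obtain ⟨k, h1, h2⟩ := ((key ℓ hℓ).and (hinf.eventually_ge_atTop R₁)).exists
    exact ⟨_, h2, h1⟩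
  · obtain ⟨k, hk⟩ := (key ℓ hℓ).exists
    exact ⟨φ k, hk⟩

namespace Normalized

variable {n : ℕ} {A : Set (Euc n)} {u : Euc n → ℝ} {M : ℝ}

lemma exists_blowdown (H : Normalized A u M) : ∃ e : Euc n, ‖e‖ = 1 ∧ IsBlowdown A u e := by
  have h : ∀ k : ℕ, ∃ R : ℝ, (k : ℝ) + 1 ≤ R ∧ ∃ e : Euc n, ‖e‖ = 1 ∧
      ∀ x ∈ Aᶜ, ‖x‖ ≤ R → |u x - ⟪e, x⟫| ≤ 1 / ((k : ℝ) + 1) * R := fun k =>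
    ((eventually_ge_atTop ((k : ℝ) + 1)).and
      (H.exists_approx_linear (ℓ := 1 / ((k : ℝ) + 1)) (by positivity))).exists
  choose R hR e he happ using h
  obtain ⟨f, hf, hB, -⟩ := exists_subseq_blowdown hR he happ
  exact ⟨f, hf, hB⟩

/-- A function of slope one at infinity is asymptotically linear. -/
lemma exists_tendsto (H : Normalized A u M) : ∃ e : Euc n, ‖e‖ = 1 ∧
    Tendsto (fun x => (u x - ⟪e, x⟫) / ‖x‖) (cobounded (Euc n)) (𝓝 0) := by
  obtain ⟨e, he, hBe⟩ := H.exists_blowdown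
  refine ⟨e, he, ?_⟩
  rw [Metric.tendsto_nhds]
  by_contra! hcon
  obtain ⟨ℓ, hℓ, hfreq⟩ := hcon
  have h : ∀ k : ℕ, ∃ x : Euc n, ((k : ℝ) + 1 ≤ ‖x‖ ∧ ∃ e : Euc n, ‖e‖ = 1 ∧
      ∀ y ∈ Aᶜ, ‖y‖ ≤ ‖x‖ → |u y - ⟪e, y⟫| ≤ 1 / ((k : ℝ) + 1) * ‖x‖) ∧
      ℓ ≤ dist ((u x - ⟪e, x⟫) / ‖x‖) 0 := fun k =>
    ((hfreq.and_eventually (tendsto_norm_cobounded_atTop.eventually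
      ((eventually_ge_atTop ((k : ℝ) + 1)).and
      (H.exists_approx_linear (ℓ := 1 / ((k : ℝ) + 1)) (by positivity))))).exists).imp
      fun x hx => ⟨hx.2, hx.1⟩
  choose x hx using h
  choose hR d hd happ using fun k => (hx k).1
  obtain ⟨f, hf, hBf, hk⟩ := exists_subseq_blowdown hR hd happ
  rw [← H.blowdown_unique he hf hBe hBf] at hk
  obtain ⟨k, hk⟩ := hk (ℓ / 2) (by positivity)
  have hk1 : 1 ≤ ‖x k‖ := by linarith [hR k, (Nat.cast_nonneg k : (0 : ℝ) ≤ k)]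
  have h1 := hk (x k) (H.mem_compl hk1) le_rfl
  have h2 := (hx k).2
  rw [dist_zero_right, norm_div, norm_norm, Real.norm_eq_abs, le_div_iff₀ (by linarith)] at h2
  have : ℓ / 2 * ‖x k‖ < ℓ * ‖x k‖ := by gcongr; linarith
  linarith

end Normalized

lemma CmpBelow.neg {n : ℕ} {Ω : Set (Euc n)} {u : Euc n → ℝ} (h : CmpBelow Ω u) :
    CmpAbove Ω (fun x => -u x) := by
  intro V hV hVb hVc x₀ a b hfr x hx
  have := h V hV hVb hVc x₀ (-a) (-b) (fun y hy => by linarith [hfr y hy]) x hx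
  linarith

lemma CmpAbove.const_mul {n : ℕ} {Ω : Set (Euc n)} {u : Euc n → ℝ} (h : CmpAbove Ω u) {c : ℝ}
    (hc : 0 < c) : CmpAbove Ω (fun x => c * u x) := by
  intro V hV hVb hVc x₀ a b hfr x hx
  have e : ∀ y : Euc n, a / c * ‖y - x₀‖ + b / c = (a * ‖y - x₀‖ + b) / c := fun y => by
    field_simp
  have := h V hV hVb hVc x₀ (a / c) (b / c) (fun y hy => by
    rw [e, le_div_iff₀ hc, mul_comm]; exact hfr y hy) x hx
  rwa [e, le_div_iff₀ hc, mul_comm] at this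

lemma SM_eq_SP_neg {n : ℕ} (Ω : Set (Euc n)) (u : Euc n → ℝ) :
    SM Ω u = SP Ω (fun x => -u x) := by
  have h : ∀ s : Set (Euc n), sInf (u '' s) = -sSup ((fun x => -u x) '' s) := fun s => by
    rw [Real.sInf_def, ← image_neg_eq_neg, image_image]
  ext r
  rw [SM, SP, mM, mP, h, h]
  congr 1
  rw [min_neg_neg]
  ring

lemma eventually_sphere_bounds {n : ℕ} {A : Set (Euc n)} (hA1 : A ⊆ ball 0 1) {u : Euc n → ℝ}
    (hu : ContinuousOn u (closure Aᶜ)) {S : ℝ} (hS : 0 < S)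
    (hSp : Tendsto (SP Aᶜ u) atTop (𝓝 S)) {δ : ℝ} (hδ : 0 < δ) :
    ∀ᶠ r : ℝ in atTop, (∀ x, ‖x‖ = r → u x ≤ (1 + δ) * (S * r)) ∧
      ∃ x, ‖x‖ = r ∧ (1 - δ) * (S * r) ≤ u x := by
  obtain ⟨d, hd⟩ : ∃ d, d = min δ 1 * S / 2 := ⟨_, rfl⟩
  have hd0 : 0 < d := by rw [hd]; positivity
  have hdS : d ≤ S / 2 := by
    rw [hd]
    have : min δ 1 * S ≤ 1 * S := by gcongr; exact min_le_right _ _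
    linarith
  have hdδ : d ≤ δ * S / 2 := by
    rw [hd]
    have : min δ 1 * S ≤ δ * S := by gcongr; exact min_le_left _ _
    linarith
  have hlim1 := hSp.eventually_le_const (show S < S + d by linarith)
  have hlim2 := hSp.eventually_const_le (show S - d < S by linarith)
  filter_upwards [hlim1, hlim2, eventually_ge_atTop 1, eventually_gt_atTop (2 * |mP Aᶜ u| / S),
    eventually_ge_atTop (|mP Aᶜ u| / d)] with r h1 h2 hr hr1 hr2
  have hr0 : 0 < r := by linarith
  rw [div_lt_iff₀ hS] at hr1
  rw [div_le_iff₀ hd0] at hr2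
  rw [SP, div_le_iff₀ hr0] at h1
  rw [SP, le_div_iff₀ hr0] at h2
  have m1 := le_abs_self (mP Aᶜ u)
  have m2 := neg_abs_le (mP Aᶜ u)
  have hcpt : IsCompact (sphere (0 : Euc n) r) := isCompact_sphere _ _
  have hcont : ContinuousOn u (sphere (0 : Euc n) r) := hu.mono fun x hx => subset_closure
    fun hxA => by
      have := hA1 hxA
      rw [mem_sphere_zero_iff_norm] at hx
      rw [mem_ball_zero_iff] at this
      linarith
  have hrd : r * d ≤ r * (S / 2) := by gcongr
  constructor
  · intro x hx
    have h3 : u x ≤ sSup (u '' sphere (0 : Euc n) r) :=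
      le_csSup (hcpt.image_of_continuousOn hcont).bddAbove
        ⟨x, mem_sphere_zero_iff_norm.2 hx, rfl⟩
    have h4 := le_max_left (sSup (u '' sphere (0 : Euc n) r)) (mP Aᶜ u)
    have h5 : r * d ≤ r * (δ * S / 2) := by gcongr
    linarith
  · have hlt : mP Aᶜ u < max (sSup (u '' sphere (0 : Euc n) r)) (mP Aᶜ u) := by
      have : 0 < S * r := by positivity
      linarith
    rcases lt_max_iff.1 hlt with h | h
    swap
    · exact absurd h (lt_irrefl _)
    rw [max_eq_left h.le] at h2
    have hne : (sphere (0 : Euc n) r).Nonempty := by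
      by_contra hemp
      rw [not_nonempty_iff_eq_empty.1 hemp, image_empty, Real.sSup_empty] at h2
      linarith
    obtain ⟨x, hx, hxe⟩ := hcpt.exists_sSup_image_eq hne hcont
    rw [hxe] at h2
    have h5 : r * d ≤ r * (δ * S / 2) := by gcongr
    exact ⟨x, mem_sphere_zero_iff_norm.1 hx, by linarith⟩

lemma exists_frontier_bound {n : ℕ} {A : Set (Euc n)} (hAcl : IsClosed A) (hAbd : IsBounded A)
    {u : Euc n → ℝ} (hu : ContinuousOn u (closure Aᶜ)) :
    ∃ M, 0 ≤ M ∧ ∀ x ∈ frontier Aᶜ, |u x| ≤ M := by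
  have hc : IsCompact (frontier Aᶜ) := by
    refine Metric.isCompact_of_isClosed_isBounded isClosed_frontier ?_
    rw [frontier_compl]
    exact hAbd.subset hAcl.frontier_subset
  obtain ⟨M, hM⟩ := hc.exists_bound_of_continuousOn (hu.mono frontier_subset_closure)
  exact ⟨max M 0, le_max_right _ _, fun x hx => (hM x hx).trans (le_max_left _ _)⟩

lemma exists_normalized {n : ℕ} {A : Set (Euc n)} (hAcl : IsClosed A) (hAbd : IsBounded A)
    (h0A : (0 : Euc n) ∈ A) (hA1 : A ⊆ ball 0 1) {u : Euc n → ℝ}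
    (hu : ContinuousOn u (closure Aᶜ)) (hIH : InfHarmonic Aᶜ u) {S : ℝ} (hS : 0 < S)
    (hSp : Tendsto (SP Aᶜ u) atTop (𝓝 S)) (hSm : Tendsto (SM Aᶜ u) atTop (𝓝 S)) :
    ∃ M, Normalized A (fun x => S⁻¹ * u x) M := by
  have hS' : 0 < S⁻¹ := inv_pos.2 hS
  have hv : ContinuousOn (fun x => S⁻¹ * u x) (closure Aᶜ) := continuousOn_const.mul hu
  obtain ⟨M, hM0, hM⟩ := exists_frontier_bound hAcl hAbd hv
  rw [SM_eq_SP_neg] at hSm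
  have hB1 : ∀ δ : ℝ, 0 < δ → _ := fun δ hδ => eventually_sphere_bounds hA1 hu hS hSp hδ
  have hB2 : ∀ δ : ℝ, 0 < δ → _ := fun δ hδ =>
    eventually_sphere_bounds (u := fun x => -u x) hA1 hu.neg hS hSm hδ
  refine ⟨M, ⟨hAcl, hA1, h0A, hv, hIH.1.const_mul hS', ?_, hM, hM0, fun δ hδ => ?_,
    fun δ hδ => ?_, fun δ hδ => ?_⟩⟩
  · have := hIH.2.neg.const_mul hS'
    simpa only [mul_neg] using this
  · obtain ⟨R, hR⟩ := eventually_atTop.1 ((hB1 δ hδ).and (hB2 δ hδ))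
    refine ⟨R, fun x hx => ?_⟩
    have h1 := (hR _ hx).1.1 x rfl
    have h2 := (hR _ hx).2.1 x rfl
    rw [abs_mul, abs_of_pos hS', inv_mul_le_iff₀ hS, abs_le]
    constructor <;> linarith
  · filter_upwards [hB1 δ hδ] with r ⟨_, x, hx, hxr⟩
    refine ⟨x, hx, ?_⟩
    rw [le_inv_mul_iff₀ hS]
    linarith
  · filter_upwards [hB2 δ hδ] with r ⟨_, x, hx, hxr⟩
    refine ⟨x, hx, ?_⟩
    rw [← mul_neg, le_inv_mul_iff₀ hS]
    linarith

/-- Theorem 1(iv): if S⁻_∞ = S⁺_∞ > 0 then there exists a with |a| = S_∞ and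
u(x) = a·x + o(|x|) as x → ∞. -/
theorem stmt7 {n : ℕ} (A : Set (Euc n)) (hAcl : IsClosed A) (hAbd : IsBounded A)
    (h0A : (0 : Euc n) ∈ A) (hA1 : A ⊆ ball 0 1)
    (u : Euc n → ℝ) (hu : ContinuousOn u (closure Aᶜ)) (hIH : InfHarmonic Aᶜ u)
    (hgrow : IsBoundedUnder (· ≤ ·) (cobounded (Euc n)) fun x => |u x| / ‖x‖)
    (Sp Sm : ℝ) (hSp : Tendsto (SP Aᶜ u) atTop (𝓝 Sp))
    (hSm : Tendsto (SM Aᶜ u) atTop (𝓝 Sm)) (heq : Sm = Sp) (hpos : 0 < Sp) :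
    ∃ a : Euc n, ‖a‖ = max Sp Sm ∧
      Tendsto (fun x => (u x - ⟪a, x⟫) / ‖x‖) (cobounded (Euc n)) (𝓝 0) := by
  subst heq
  obtain ⟨M, H⟩ := exists_normalized hAcl hAbd h0A hA1 hu hIH hpos hSp hSm
  obtain ⟨e, he, hlim⟩ := H.exists_tendsto
  refine ⟨Sm • e, ?_, ?_⟩
  · rw [max_self, norm_smul, he, Real.norm_of_nonneg hpos.le, mul_one]
  · have := hlim.const_mul Sm
    rw [mul_zero] at this
    refine this.congr fun x => ?_
    rw [inner_smul_left, conj_trivial]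
    field_simp
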